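/- (Shape theorem for linear cocycles over ℤ^d.) Let d ≥ 1 and k ≥ 1, let T be an ergodic measure-preserving ℤ^d-action on a probability space (X,μ), and let S : ℤ^d × X → GL_k(ℝ) be a measurable map with S(0,x) = I and S(n+m,x) = S(n, T_m x)·S(m,x) for all n,m ∈ ℤ^d and almost every x. Define ρ_x(m,n) = max( log⁺‖S(n,x)·S(m,x)⁻¹‖, log⁺‖S(m,x)·S(n,x)⁻¹‖ ), where ‖·‖ is the operator norm on k×k real matrices and log⁺ t = max(log t, 0). Suppose that for some ε > 0, ∫_X (log⁺‖S(n,x)‖)^{d+ε} dμ(x) < ∞ for every n ∈ ℤ^d with |n| = 1. Then there exists a seminorm L on ℝ^d such that for μ-almost every x, (ρ_x(0,n) − L(n))/|n| → 0 as |n| → ∞; that is, for every δ > 0 there are only finitely many n ∈ ℤ^d with |ρ_x(0,n) − L(n)| ≥ δ|n|. -/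

import Mathlib

open MeasureTheory

open Filter Topology Set
open scoped ENNReal

theorem subadditive_le_of_exists {X : Type*} {τ : X → X} {a : ℕ → X → ℝ} {g : X → ℝ} {c : ℝ} {M : ℕ}
    {bad : Set X} (hsub : ∀ i j x, a (i + j) x ≤ a i x + a j (τ^[i] x)) (ha0 : ∀ x, a 0 x ≤ 0)
    (hg : ∀ x, 0 ≤ g x) (h1 : ∀ x, a 1 x ≤ c + g x)
    (hgood : ∀ x ∉ bad, ∃ N, 1 ≤ N ∧ N ≤ M ∧ a N x ≤ c * N) (J : ℕ) (x : X) :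
    a J x ≤ c * J + ∑ i ∈ Finset.range J, bad.indicator g (τ^[i] x)
      + ∑ i ∈ Finset.Ico (J - M) J, g (τ^[i] x) := by
  have hind : ∀ y, 0 ≤ bad.indicator g y := fun y => indicator_nonneg (fun z _ => hg z) y
  induction J using Nat.strong_induction_on generalizing x with
  | _ J ih =>
  by_cases hJM : J ≤ M
  · have key : ∀ K x, a K x ≤ c * K + ∑ i ∈ Finset.range K, g (τ^[i] x) := by
      intro K
      induction K with
      | zero => intro x; simpa using ha0 x
      | succ K ihK =>
        intro x
        have := hsub K 1 x
        rw [Finset.sum_range_succ]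
        have h2 := ihK x
        have h3 := h1 (τ^[K] x)
        push_cast
        linarith
    have h0 : J - M = 0 := by omega
    rw [h0, ← Finset.range_eq_Ico]
    have := key J x
    have h2 : 0 ≤ ∑ i ∈ Finset.range J, bad.indicator g (τ^[i] x) :=
      Finset.sum_nonneg fun i _ => hind _
    linarith
  · have step : ∀ N, 1 ≤ N → N ≤ J → a N x ≤ c * N + ∑ i ∈ Finset.range N,
        bad.indicator g (τ^[i] x) → a J x ≤ c * J + ∑ i ∈ Finset.range J, bad.indicator g (τ^[i] x)
      + ∑ i ∈ Finset.Ico (J - M) J, g (τ^[i] x) := by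
      intro N hN hNJ haN
      have e1 := hsub N (J - N) x
      rw [Nat.add_sub_cancel' hNJ] at e1
      have e2 := ih (J - N) (by omega) (τ^[N] x)
      simp only [← Function.iterate_add_apply] at e2
      have e3 : ∑ i ∈ Finset.range J, bad.indicator g (τ^[i] x)
          = ∑ i ∈ Finset.range N, bad.indicator g (τ^[i] x)
            + ∑ i ∈ Finset.range (J - N), bad.indicator g (τ^[i + N] x) := by
        conv_lhs => rw [← Nat.add_sub_cancel' hNJ, Finset.sum_range_add]
        simp only [add_comm]
      have e4 : ∑ i ∈ Finset.Ico (J - N - M) (J - N), g (τ^[i + N] x)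
          ≤ ∑ i ∈ Finset.Ico (J - M) J, g (τ^[i] x) := by
        rw [Finset.sum_Ico_add' (fun i => g (τ^[i] x)), Nat.sub_add_cancel hNJ]
        refine Finset.sum_le_sum_of_subset_of_nonneg ?_ fun i _ _ => hg _
        exact Finset.Ico_subset_Ico (by omega) le_rfl
      have e5 : ((J - N : ℕ) : ℝ) = J - N := Nat.cast_sub hNJ
      rw [e5] at e2
      linarith
    by_cases hx : x ∈ bad
    · refine step 1 le_rfl (by omega) ?_
      simpa [indicator_of_mem hx] using h1 x
    · obtain ⟨N, hN, hNM, h⟩ := hgood x hx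
      refine step N hN (by omega) ?_
      have h2 : 0 ≤ ∑ i ∈ Finset.range N, bad.indicator g (τ^[i] x) :=
        Finset.sum_nonneg fun i _ => hind _
      linarith

/-- If almost every orbit sees a subadditive cocycle `a` drop to slope `c` at some time, then the
means of `a` grow at slope at most `c`. -/
theorem eventually_integral_subadditive_le {X : Type*} [MeasurableSpace X] {μ : Measure X}
    [IsProbabilityMeasure μ] {τ : X → X} (hτ : MeasurePreserving τ μ μ) {a : ℕ → X → ℝ} {c : ℝ}
    (ham : ∀ j, Measurable (a j)) (hai : ∀ j, Integrable (a j) μ)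
    (hsub : ∀ i j x, a (i + j) x ≤ a i x + a j (τ^[i] x)) (ha0 : ∀ x, a 0 x ≤ 0)
    (hex : ∀ᵐ x ∂μ, ∃ N, 1 ≤ N ∧ a N x ≤ c * N) {η : ℝ} (hη : 0 < η) :
    ∀ᶠ J : ℕ in atTop, ∫ x, a J x ∂μ ≤ (c + η) * J := by
  set g : X → ℝ := fun x => |a 1 x| + |c| with hgdef
  have hgi : Integrable g μ := (hai 1).abs.add (integrable_const _)
  have hgm : Measurable g := by fun_prop
  have hg : ∀ x, 0 ≤ g x := fun x => by positivity
  have h1 : ∀ x, a 1 x ≤ c + g x := fun x => by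
    have := le_abs_self (a 1 x)
    have := neg_abs_le c
    simp only [hgdef]; linarith
  set bad : ℕ → Set X := fun M => ⋂ N ∈ Finset.Icc 1 M, {x | c * N < a N x} with hbad
  have hbm : ∀ M, MeasurableSet (bad M) := fun M =>
    Finset.measurableSet_biInter _ fun N _ => measurableSet_lt measurable_const (ham N)
  have hanti : Antitone bad := fun M M' h => by
    refine biInter_subset_biInter_left ?_
    intro N hN
    simp only [Finset.mem_coe, Finset.mem_Icc] at hN ⊢
    exact ⟨hN.1, hN.2.trans h⟩
  have hnull : μ (⋂ M, bad M) = 0 := by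
    refine measure_mono_null ?_ hex
    intro x hx hx'
    obtain ⟨N, hN, h⟩ := hx'
    simp only [hbad, mem_iInter, Finset.mem_Icc, mem_ofPred_eq] at hx
    exact absurd h (not_le.2 (hx N N ⟨hN, le_rfl⟩))
  have hlim := tendsto_setIntegral_of_antitone hbm hanti ⟨0, hgi.integrableOn⟩
  rw [setIntegral_measure_zero _ hnull] at hlim
  obtain ⟨M, hM⟩ := ((tendsto_order.1 hlim).2 (η / 2) (by positivity)).exists
  have hit : ∀ (h : X → ℝ) i, Integrable h μ → Integrable (fun x => h (τ^[i] x)) μ := fun h i hh =>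
    (hτ.iterate i).integrable_comp_of_integrable hh
  have hie : ∀ (h : X → ℝ) i, Measurable h → ∫ x, h (τ^[i] x) ∂μ = ∫ x, h x ∂μ := fun h i hh => by
    have := integral_map (μ := μ) (hτ.iterate i).measurable.aemeasurable
      (f := h) hh.aestronglyMeasurable
    rw [(hτ.iterate i).map_eq] at this
    exact this.symm
  have hbi : Integrable ((bad M).indicator g) μ := hgi.indicator (hbm M)
  have hbme : Measurable ((bad M).indicator g) := hgm.indicator (hbm M)
  have main : ∀ J, ∫ x, a J x ∂μ ≤ (c + η / 2) * J + M * ∫ x, g x ∂μ := by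
    intro J
    have hle : ∀ x, a J x ≤ c * J + ∑ i ∈ Finset.range J, (bad M).indicator g (τ^[i] x)
      + ∑ i ∈ Finset.Ico (J - M) J, g (τ^[i] x) := by
      intro x
      refine subadditive_le_of_exists hsub ha0 hg h1 ?_ J x
      intro y hy
      simp only [hbad, mem_iInter, Finset.mem_Icc, mem_ofPred_eq, not_forall, not_lt] at hy
      obtain ⟨N, hN, h⟩ := hy
      exact ⟨N, hN.1, hN.2, h⟩
    have i1 : Integrable (fun x => ∑ i ∈ Finset.range J, (bad M).indicator g (τ^[i] x)) μ :=
      integrable_finsetSum _ fun i _ => hit _ i hbi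
    have i2 : Integrable (fun x => ∑ i ∈ Finset.Ico (J - M) J, g (τ^[i] x)) μ :=
      integrable_finsetSum _ fun i _ => hit _ i hgi
    have i3 : Integrable (fun x => c * J
        + ∑ i ∈ Finset.range J, (bad M).indicator g (τ^[i] x)) μ := (integrable_const _).add i1
    have := integral_mono (hai J) (i3.add i2) hle
    simp only [Pi.add_apply] at this
    rw [integral_add i3 i2, integral_add (integrable_const _) i1,
      integral_finsetSum _ fun i _ => hit _ i hbi, integral_finsetSum _ fun i _ => hit _ i hgi]
      at this
    simp only [hie _ _ hbme, hie _ _ hgm, integral_const, Finset.sum_const, Finset.card_range,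
      Nat.card_Ico, integral_indicator (hbm M), probReal_univ, one_smul, nsmul_eq_mul] at this
    have e1 : ((J - (J - M) : ℕ) : ℝ) ≤ M := by exact_mod_cast (by omega)
    have e2 : 0 ≤ ∫ x, g x ∂μ := integral_nonneg hg
    have e3 := mul_le_mul_of_nonneg_right e1 e2
    have e4 := mul_le_mul_of_nonneg_left hM.le (Nat.cast_nonneg (α := ℝ) J)
    linarith
  have hev : ∀ᶠ J : ℕ in atTop, M * (∫ x, g x ∂μ) / (η / 2) ≤ J :=
    tendsto_natCast_atTop_atTop.eventually_ge_atTop _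
  filter_upwards [hev] with J hJ
  rw [div_le_iff₀ (by positivity)] at hJ
  have := main J
  linarith

/-- The cube of side `2 * r + 1` centred at `p` in `ℤ^d`. -/
noncomputable def latticeCube {d : ℕ} (p : Fin d → ℤ) (r : ℕ) : Finset (Fin d → ℤ) :=
  Finset.Icc (fun i => p i - r) (fun i => p i + r)

theorem mem_latticeCube {d : ℕ} {p q : Fin d → ℤ} {r : ℕ} :
    q ∈ latticeCube p r ↔ ∀ i, |q i - p i| ≤ r := by
  simp only [latticeCube, Finset.mem_Icc, Pi.le_def, ← forall_and, abs_le]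
  exact forall_congr' fun i => by omega

theorem card_latticeCube {d : ℕ} (p : Fin d → ℤ) (r : ℕ) :
    (latticeCube p r).card = (2 * r + 1) ^ d := by
  rw [latticeCube, Pi.card_Icc]
  have : ∀ i : Fin d, (Finset.Icc (p i - (r : ℤ)) (p i + r)).card = 2 * r + 1 := fun i => by
    rw [Int.card_Icc]; omega
  simp [this]

theorem coe_latticeCube {d : ℕ} (p : Fin d → ℤ) (r : ℕ) :
    (latticeCube p r : Set (Fin d → ℤ)) = Metric.closedBall p r := by
  ext q
  rw [Finset.mem_coe, mem_latticeCube, Metric.mem_closedBall, dist_pi_le_iff (by positivity)]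
  refine forall_congr' fun i => ?_
  rw [Int.dist_eq]
  exact_mod_cast Iff.rfl

theorem mul_card_le_of_cubes {d : ℕ} (H : (Fin d → ℤ) → ℝ≥0∞) (E : Finset (Fin d → ℤ))
    (r : (Fin d → ℤ) → ℕ) (M : ℕ) (hr : ∀ p ∈ E, r p ≤ M) (B : Finset (Fin d → ℤ))
    (hB : ∀ p ∈ E, latticeCube p (r p) ⊆ B) (t : ℝ≥0∞)
    (h : ∀ p ∈ E, t * (2 * r p + 1) ^ d ≤ ∑ q ∈ latticeCube p (r p), H q) :
    t * E.card ≤ 4 ^ d * ∑ q ∈ B, H q := by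
  obtain ⟨u, huE, hdisj, hcov⟩ := Vitali.exists_disjoint_subfamily_covering_enlargement_closedBall
    (E : Set (Fin d → ℤ)) id (fun p => (r p : ℝ)) M (fun p hp => by exact_mod_cast hr p hp) 4
    (by norm_num)
  obtain ⟨u, rfl⟩ : ∃ u' : Finset (Fin d → ℤ), (u' : Set _) = u :=
    (E.finite_toSet.subset huE).exists_finset_coe
  have hsub : E ⊆ u.biUnion fun b => latticeCube b (4 * r b) := by
    intro p hp
    obtain ⟨b, hb, hpb⟩ := hcov p hp
    refine Finset.mem_biUnion.2 ⟨b, hb, ?_⟩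
    rw [← Finset.mem_coe, coe_latticeCube]
    have := hpb (Metric.mem_closedBall_self (by positivity))
    simpa using this
  have hcard : (E.card : ℝ≥0∞) ≤ ∑ b ∈ u, 4 ^ d * (2 * r b + 1) ^ d := by
    have h1 : E.card ≤ ∑ b ∈ u, 4 ^ d * (2 * r b + 1) ^ d := by
      refine (Finset.card_le_card hsub).trans (Finset.card_biUnion_le.trans ?_)
      refine Finset.sum_le_sum fun b _ => ?_
      rw [card_latticeCube, ← mul_pow]
      exact Nat.pow_le_pow_left (by omega) d
    exact_mod_cast h1
  calc t * E.card ≤ t * ∑ b ∈ u, 4 ^ d * (2 * r b + 1) ^ d := by gcongr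
    _ = 4 ^ d * ∑ b ∈ u, t * (2 * r b + 1) ^ d := by
      push_cast
      rw [← Finset.mul_sum, ← Finset.mul_sum]; ring
    _ ≤ 4 ^ d * ∑ b ∈ u, ∑ q ∈ latticeCube b (r b), H q := by
      gcongr with b hb
      exact h b (huE hb)
    _ = 4 ^ d * ∑ q ∈ u.biUnion fun b => latticeCube b (r b), H q := by
      rw [Finset.sum_biUnion]
      intro a ha b hb hab
      have := hdisj ha hb hab
      simp only [Function.onFun, id, ← coe_latticeCube] at this
      exact Finset.disjoint_coe.1 this
    _ ≤ 4 ^ d * ∑ q ∈ B, H q := by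
      gcongr
      exact Finset.biUnion_subset.2 fun b hb => hB b (huE hb)

section Action

variable {X : Type*} [MeasurableSpace X] {μ : Measure X} {d : ℕ} {T : (Fin d → ℤ) → X → X}

theorem maximal_weak_type [IsProbabilityMeasure μ]
    (hTadd : ∀ n m : Fin d → ℤ, T (n + m) = T n ∘ T m)
    (hTmp : ∀ n : Fin d → ℤ, MeasurePreserving (T n) μ μ)
    {h : X → ℝ≥0∞} (hm : Measurable h) (t : ℝ≥0∞) (M : ℕ) :
    t * μ {x | ∃ N ≤ M, t * (2 * N + 1) ^ d ≤ ∑ p ∈ latticeCube 0 N, h (T p x)}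
      ≤ 8 ^ d * ∫⁻ x, h x ∂μ := by
  classical
  set E := {x | ∃ N ≤ M, t * (2 * N + 1) ^ d ≤ ∑ p ∈ latticeCube 0 N, h (T p x)} with hE
  have hEm : MeasurableSet E := by
    have : E = ⋃ N ∈ Finset.Iic M,
        {x | t * (2 * N + 1) ^ d ≤ ∑ p ∈ latticeCube 0 N, h (T p x)} := by
      ext x; simp [hE]
    rw [this]
    refine Finset.measurableSet_biUnion _ fun N _ => measurableSet_le measurable_const ?_
    exact Finset.measurable_fun_sum _ fun p _ => hm.comp (hTmp p).measurable
  have hpt : ∀ x, ∑ p ∈ latticeCube 0 M, t * E.indicator 1 (T p x)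
      ≤ 4 ^ d * ∑ q ∈ latticeCube 0 (2 * M), h (T q x) := by
    intro x
    have hex : ∀ p, ∃ N : ℕ, T p x ∈ E →
        N ≤ M ∧ t * (2 * N + 1) ^ d ≤ ∑ q ∈ latticeCube 0 N, h (T q (T p x)) := by
      intro p
      by_cases hp : T p x ∈ E
      · obtain ⟨N, h1, h2⟩ := hp
        exact ⟨N, fun _ => ⟨h1, h2⟩⟩
      · exact ⟨0, fun hp' => absurd hp' hp⟩
    choose r hr using hex
    have := mul_card_le_of_cubes (fun q => h (T q x)) ((latticeCube 0 M).filter (T · x ∈ E)) r M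
      (fun p hp => (hr p (Finset.mem_filter.1 hp).2).1) (latticeCube 0 (2 * M)) ?_ t ?_
    · refine le_trans (le_of_eq ?_) this
      rw [← Finset.mul_sum, Finset.card_filter]
      congr 1
      push_cast
      exact Finset.sum_congr rfl fun p _ => by simp [indicator_apply]
    · intro p hp q hq
      rw [Finset.mem_filter, mem_latticeCube] at hp
      rw [mem_latticeCube] at hq ⊢
      intro i
      have h1 := hp.1 i
      have h2 := hq i
      have h3 := (hr p hp.2).1
      simp only [Pi.zero_apply, sub_zero, abs_le] at *
      push_cast
      omega
    · intro p hp
      rw [Finset.mem_filter] at hp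
      refine (hr p hp.2).2.trans (le_of_eq ?_)
      refine Finset.sum_bij (fun q _ => q + p) ?_ ?_ ?_ ?_
      · intro q hq
        rw [mem_latticeCube] at hq ⊢
        simpa using hq
      · intro a _ b _ hab
        exact add_right_cancel hab
      · intro q hq
        refine ⟨q - p, ?_, by simp⟩
        rw [mem_latticeCube] at hq ⊢
        simpa using hq
      · intro q _
        rw [hTadd]; rfl
  have hint := lintegral_mono (μ := μ) hpt
  have hcomp : ∀ (g : X → ℝ≥0∞) p, Measurable g → ∫⁻ x, g (T p x) ∂μ = ∫⁻ x, g x ∂μ :=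
    fun g p hg => (hTmp p).lintegral_comp hg
  have him : Measurable (E.indicator (1 : X → ℝ≥0∞)) := measurable_one.indicator hEm
  have himT : ∀ p, Measurable fun x => E.indicator (1 : X → ℝ≥0∞) (T p x) :=
    fun p => him.comp (hTmp p).measurable
  have hmT : ∀ p, Measurable fun x => h (T p x) := fun p => hm.comp (hTmp p).measurable
  rw [lintegral_finsetSum _ fun p _ => (himT p).const_mul t,
    lintegral_const_mul _ (Finset.measurable_fun_sum _ fun p _ => hmT p),
    lintegral_finsetSum _ fun p _ => hmT p] at hint
  have e1 : ∀ p, ∫⁻ x, t * E.indicator 1 (T p x) ∂μ = t * μ E := fun p => by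
    rw [lintegral_const_mul _ (himT p), hcomp _ _ him, lintegral_indicator_one hEm]
  simp only [e1, hcomp _ _ hm, Finset.sum_const, card_latticeCube, nsmul_eq_mul] at hint
  have hc0 : ((2 * M + 1 : ℕ) ^ d : ℝ≥0∞) ≠ 0 := by
    exact_mod_cast (pow_pos (Nat.succ_pos _) d).ne'
  have hct : ((2 * M + 1 : ℕ) ^ d : ℝ≥0∞) ≠ ⊤ := by
    exact_mod_cast ENNReal.natCast_ne_top ((2 * M + 1) ^ d)
  refine (ENNReal.mul_le_mul_iff_right hc0 hct).1 ?_
  push_cast at hint ⊢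
  refine hint.trans ?_
  have e2 : ((2 * (2 * M) + 1 : ℕ) ^ d : ℝ≥0∞) ≤ (2 ^ d * (2 * M + 1) ^ d : ℕ) := by
    rw [← mul_pow]
    exact_mod_cast Nat.pow_le_pow_left (by omega) d
  push_cast at e2
  calc (4 : ℝ≥0∞) ^ d * ((2 * (2 * M) + 1) ^ d * ∫⁻ x, h x ∂μ)
      ≤ 4 ^ d * ((2 ^ d * (2 * M + 1) ^ d) * ∫⁻ x, h x ∂μ) := by gcongr
    _ = (4 * 2) ^ d * ((2 * M + 1) ^ d * ∫⁻ x, h x ∂μ) := by rw [mul_pow]; ring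
    _ = (2 * M + 1) ^ d * (8 ^ d * ∫⁻ x, h x ∂μ) := by norm_num; ring

theorem ae_exists_cube_sum_le [IsProbabilityMeasure μ]
    (hTadd : ∀ n m : Fin d → ℤ, T (n + m) = T n ∘ T m)
    (hTmp : ∀ n : Fin d → ℤ, MeasurePreserving (T n) μ μ)
    {h : X → ℝ≥0∞} (hm : Measurable h) (hfin : ∫⁻ x, h x ∂μ ≠ ⊤) :
    ∀ᵐ x ∂μ, ∃ A : ℕ, ∀ N : ℕ, ∑ p ∈ latticeCube 0 N, h (T p x) ≤ A * (2 * N + 1) ^ d := by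
  set C := 8 ^ d * ∫⁻ x, h x ∂μ
  have hC : C ≠ ⊤ := ENNReal.mul_ne_top (by simp) hfin
  have hbound : ∀ A : ℕ, A * μ {x | ∃ N : ℕ, (A : ℝ≥0∞) * (2 * N + 1) ^ d ≤
      ∑ p ∈ latticeCube 0 N, h (T p x)} ≤ C := by
    intro A
    have hU : {x | ∃ N : ℕ, (A : ℝ≥0∞) * (2 * N + 1) ^ d ≤ ∑ p ∈ latticeCube 0 N, h (T p x)}
        = ⋃ M : ℕ, {x | ∃ N ≤ M, (A : ℝ≥0∞) * (2 * N + 1) ^ d ≤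
          ∑ p ∈ latticeCube 0 N, h (T p x)} := by
      ext x
      simp only [mem_ofPred_eq, mem_iUnion]
      exact ⟨fun ⟨N, hN⟩ => ⟨N, N, le_rfl, hN⟩, fun ⟨_, N, _, hN⟩ => ⟨N, hN⟩⟩
    rw [hU, Monotone.measure_iUnion, ENNReal.mul_iSup]
    · exact iSup_le fun M => maximal_weak_type hTadd hTmp hm A M
    · rintro M M' hMM' x ⟨N, hN, hx⟩
      exact ⟨N, hN.trans hMM', hx⟩
  rw [ae_iff]
  by_contra hne
  set F := {x | ¬∃ A : ℕ, ∀ N : ℕ, ∑ p ∈ latticeCube 0 N, h (T p x) ≤ A * (2 * N + 1) ^ d}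
  have hF : ∀ A : ℕ, A * μ F ≤ C := fun A => by
    refine le_trans ?_ (hbound A)
    gcongr
    intro x hx
    simp only [F, mem_ofPred_eq, not_exists, not_forall, not_le] at hx ⊢
    obtain ⟨N, hN⟩ := hx A
    exact ⟨N, hN.le⟩
  obtain ⟨A, hA⟩ := ENNReal.exists_nat_mul_gt hne hC
  exact absurd (hF A) (not_le.2 hA)

end Action

/-- The cube `[0, s)^d` in `ℤ^d`. -/
noncomputable def cornerCube (d s : ℕ) : Finset (Fin d → ℤ) :=
  Fintype.piFinset fun _ => Finset.Ico 0 (s : ℤ)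

theorem mem_cornerCube {d s : ℕ} {p : Fin d → ℤ} :
    p ∈ cornerCube d s ↔ ∀ i, 0 ≤ p i ∧ p i < s := by
  simp [cornerCube]

theorem card_cornerCube (d s : ℕ) : (cornerCube d s).card = s ^ d := by
  simp [cornerCube]

theorem sum_cornerCube_two_mul {d s : ℕ} (hs : 0 < s) (g : (Fin d → ℤ) → ℝ) :
    ∑ p ∈ cornerCube d (2 * s), g p
      = ∑ e ∈ cornerCube d 2, ∑ p ∈ cornerCube d s, g (p + (s : ℤ) • e) := by
  rw [← Finset.sum_product']
  have hs' : (0 : ℤ) < s := by exact_mod_cast hs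
  refine Finset.sum_bij' (fun q _ => (fun i => q i / s, fun i => q i % s))
    (fun ep _ => ep.2 + (s : ℤ) • ep.1) ?_ ?_ ?_ ?_ ?_
  · intro q hq
    rw [mem_cornerCube] at hq
    simp only [Finset.mem_product, mem_cornerCube]
    refine ⟨fun i => ⟨Int.ediv_nonneg (hq i).1 hs'.le, ?_⟩,
      fun i => ⟨Int.emod_nonneg _ hs'.ne', Int.emod_lt_of_pos _ hs'⟩⟩
    refine Int.ediv_lt_of_lt_mul hs' ?_
    have := (hq i).2
    push_cast at this ⊢
    linarith
  · intro ep hep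
    simp only [Finset.mem_product, mem_cornerCube] at hep
    rw [mem_cornerCube]
    intro i
    have h1 := hep.1 i
    have h2 := hep.2 i
    push_cast at h1 h2 ⊢
    simp only [Pi.add_apply, Pi.smul_apply, smul_eq_mul]
    constructor
    · nlinarith
    · have : ep.1 i ≤ 1 := by omega
      nlinarith
  · intro q _
    ext i
    simp [Int.emod_add_mul_ediv]
  · rintro ⟨e, p⟩ hep
    simp only [Finset.mem_product, mem_cornerCube] at hep
    ext i
    · have h2 := hep.2 i
      simp [Int.add_mul_ediv_left _ _ hs'.ne', Int.ediv_eq_zero_of_lt h2.1 h2.2]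
    · have h2 := hep.2 i
      simp [Int.emod_eq_of_lt h2.1 h2.2]
  · intro q _
    congr 1
    ext i
    simp [Int.emod_add_mul_ediv]

section Metric

variable {d : ℕ} {ρ : (Fin d → ℤ) → (Fin d → ℤ) → ℝ} {w : (Fin d → ℤ) → ℝ}

theorem sum_translate_le (hρ0 : ∀ p, ρ p p = 0) (htri : ∀ p q r, ρ p r ≤ ρ p q + ρ q r)
    (hw0 : ∀ p, 0 ≤ w p) (hw : ∀ p i, ρ p (p + Pi.single i 1) ≤ w p)
    {B B' : Finset (Fin d → ℤ)} {v : Fin d → ℤ} (hv : 0 ≤ v)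
    (hB : ∀ p ∈ B, ∀ u, 0 ≤ u → u ≤ v → p + u ∈ B') :
    ∑ p ∈ B, ρ p (p + v) ≤ (∑ i, v i : ℤ) * ∑ p ∈ B', w p := by
  obtain ⟨m, hm⟩ := Int.eq_ofNat_of_zero_le (Finset.sum_nonneg fun i _ => hv i : 0 ≤ ∑ i, v i)
  induction m generalizing v with
  | zero =>
    have : v = 0 := by
      rw [Nat.cast_zero, Finset.sum_eq_zero_iff_of_nonneg fun i _ => hv i] at hm
      ext i; exact hm i (Finset.mem_univ i)
    subst this
    simp [hρ0]
  | succ m ih =>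
    obtain ⟨i, hi⟩ : ∃ i, 0 < v i := by
      by_contra! hcon
      have := Finset.sum_nonpos fun i (_ : i ∈ Finset.univ) => hcon i
      rw [hm] at this
      push_cast at this
      omega
    set v' := v - Pi.single i 1 with hv'
    have hvv : v = v' + Pi.single i 1 := by simp [hv']
    have hs : ∑ j, v' j = m := by
      simp only [hv', Pi.sub_apply, Finset.sum_sub_distrib, hm, Finset.sum_pi_single',
        Finset.mem_univ, if_true]
      push_cast; ring
    have hv'0 : 0 ≤ v' := by
      intro j
      simp only [hv', Pi.zero_apply, Pi.sub_apply]
      by_cases hj : j = i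
      · subst hj; simp; omega
      · simpa [Pi.single_eq_of_ne hj] using hv j
    have hv'v : v' ≤ v := by
      rw [hvv]
      exact le_add_of_nonneg_right (Pi.single_nonneg.2 zero_le_one)
    have h1 := ih hv'0 (fun p hp u hu huv => hB p hp u hu (huv.trans hv'v)) hs
    have h2 : ∑ p ∈ B, ρ (p + v') (p + v) ≤ ∑ p ∈ B', w p := by
      calc ∑ p ∈ B, ρ (p + v') (p + v) ≤ ∑ p ∈ B, w (p + v') := by
            refine Finset.sum_le_sum fun p _ => ?_
            have := hw (p + v') i
            rwa [add_assoc, ← hvv] at this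
        _ = ∑ p ∈ B.map (addRightEmbedding v'), w p := by simp
        _ ≤ ∑ p ∈ B', w p := by
            refine Finset.sum_le_sum_of_subset_of_nonneg ?_ fun p _ _ => hw0 p
            intro q hq
            obtain ⟨p, hp, rfl⟩ := Finset.mem_map.1 hq
            exact hB p hp v' hv'0 hv'v
    have h3 : ∑ p ∈ B, ρ p (p + v) ≤ ∑ p ∈ B, ρ p (p + v') + ∑ p ∈ B, ρ (p + v') (p + v) := by
      rw [← Finset.sum_add_distrib]
      exact Finset.sum_le_sum fun p _ => htri _ _ _
    rw [hs] at h1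
    rw [hm]
    push_cast at h1 ⊢
    linarith

theorem sum_cornerCube_le {q Y : ℝ} (hq : 1 ≤ q) (hY : 0 ≤ Y) (hw0 : ∀ p, 0 ≤ w p)
    {B : Finset (Fin d → ℤ)} (hBY : ∑ p ∈ B, w p ^ q ≤ Y ^ q) {n : Fin d → ℤ} {k : ℕ}
    (hB : ∀ p ∈ cornerCube d (2 ^ k), n + p ∈ B) :
    ∑ p ∈ cornerCube d (2 ^ k), w (n + p) ≤ (2 ^ k) ^ d * ((2 : ℝ) ^ (-(d / q))) ^ k * Y := by
  have hq0 : 0 < q := by linarith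
  have h1 := Real.rpow_sum_le_const_mul_sum_rpow_of_nonneg (s := cornerCube d (2 ^ k))
    (f := fun p => w (n + p)) hq fun p _ => hw0 _
  have h2 : ∑ p ∈ cornerCube d (2 ^ k), w (n + p) ^ q ≤ Y ^ q := by
    refine le_trans ?_ hBY
    calc ∑ p ∈ cornerCube d (2 ^ k), w (n + p) ^ q
        = ∑ p ∈ (cornerCube d (2 ^ k)).map (addLeftEmbedding n), w p ^ q := by simp
      _ ≤ _ := by
          refine Finset.sum_le_sum_of_subset_of_nonneg ?_ fun p _ _ => Real.rpow_nonneg (hw0 p) _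
          intro p hp
          obtain ⟨p', hp', rfl⟩ := Finset.mem_map.1 hp
          exact hB p' hp'
  rw [card_cornerCube] at h1
  have hsum0 : 0 ≤ ∑ p ∈ cornerCube d (2 ^ k), w (n + p) := Finset.sum_nonneg fun p _ => hw0 _
  refine (Real.rpow_le_rpow_iff hsum0 (by positivity) hq0).1 ?_
  have hs : (0 : ℝ) < (2 ^ k) ^ d := by positivity
  have e1 : ((2 : ℝ) ^ (-(d / q))) ^ k = (((2 : ℝ) ^ k) ^ d) ^ (-(1 / q)) := by
    rw [← Real.rpow_natCast, ← Real.rpow_mul (by norm_num), ← Real.rpow_natCast,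
      ← Real.rpow_natCast, ← Real.rpow_mul (by norm_num), ← Real.rpow_mul (by norm_num)]
    congr 1
    field_simp
  rw [e1, Real.mul_rpow (by positivity) hY, Real.mul_rpow hs.le (by positivity),
    ← Real.rpow_mul hs.le]
  have e2 : -(1 / q) * q = -1 := by field_simp
  rw [e2, ← Real.rpow_add hs]
  push_cast at h1
  calc _ ≤ _ := h1
    _ ≤ _ := by
      rw [sub_eq_add_neg]
      gcongr

theorem cornerCube_avg_le {q Y : ℝ} (hq : 1 ≤ q) (hdq : (d : ℝ) < q) (hY : 0 ≤ Y)
    (hρ0 : ∀ p, ρ p p = 0) (htri : ∀ p q r, ρ p r ≤ ρ p q + ρ q r)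
    (hw0 : ∀ p, 0 ≤ w p) (hw : ∀ p i, ρ p (p + Pi.single i 1) ≤ w p)
    {B : Finset (Fin d → ℤ)} (hBY : ∑ p ∈ B, w p ^ q ≤ Y ^ q) {n : Fin d → ℤ} {k : ℕ}
    (hB : ∀ p ∈ cornerCube d (2 ^ k), n + p ∈ B) :
    ∑ p ∈ cornerCube d (2 ^ k), ρ n (n + p) ≤
      (2 ^ k) ^ d * (d * 2 ^ d * Y * ((2 * (2 : ℝ) ^ (-(d / q))) ^ k
        / (2 * (2 : ℝ) ^ (-(d / q)) - 1))) := by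
  set β := (2 : ℝ) ^ (-(d / q)) with hβ
  have hq0 : 0 < q := by linarith
  have hβ0 : 0 < β := by positivity
  have hβ1 : β ≤ 1 := Real.rpow_le_one_of_one_le_of_nonpos (by norm_num) (by
    have : 0 ≤ d / q := by positivity
    linarith)
  have hθ : 1 < 2 * β := by
    have : (2 : ℝ) ^ (-1 : ℝ) < β := Real.rpow_lt_rpow_of_exponent_lt (by norm_num) (by
      rw [neg_lt_neg_iff, div_lt_one hq0]; exact hdq)
    rw [Real.rpow_neg_one] at this
    linarith
  have hθ' : 0 < 2 * β - 1 := by linarith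
  induction k with
  | zero =>
    have : cornerCube d (2 ^ 0) = {0} := by
      ext p
      rw [mem_cornerCube, Finset.mem_singleton, funext_iff]
      refine forall_congr' fun i => ?_
      simp only [pow_zero, Nat.cast_one, Pi.zero_apply]
      omega
    rw [this]
    simp only [Finset.sum_singleton, add_zero, hρ0]
    positivity
  | succ k ih =>
    have hsub : ∀ p ∈ cornerCube d (2 ^ k), p ∈ cornerCube d (2 ^ (k + 1)) := by
      intro p hp
      rw [mem_cornerCube] at hp ⊢
      intro i
      refine ⟨(hp i).1, (hp i).2.trans_le ?_⟩
      exact_mod_cast Nat.pow_le_pow_right (by norm_num) (Nat.le_succ k)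
    have ih' := ih fun p hp => hB p (hsub p hp)
    have hsw := sum_cornerCube_le hq hY hw0 hBY hB
    rw [← hβ] at hsw
    have hsw0 : 0 ≤ ∑ p ∈ cornerCube d (2 ^ (k + 1)), w (n + p) :=
      Finset.sum_nonneg fun _ _ => hw0 _
    have hstep : ∀ e ∈ cornerCube d 2,
        ∑ p ∈ cornerCube d (2 ^ k), ρ n (n + (p + ((2 ^ k : ℕ) : ℤ) • e)) ≤
          ∑ p ∈ cornerCube d (2 ^ k), ρ n (n + p)
            + (d * 2 ^ k) * ∑ p ∈ cornerCube d (2 ^ (k + 1)), w (n + p) := by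
      intro e he
      rw [mem_cornerCube] at he
      have h1 := sum_translate_le (ρ := fun p q => ρ (n + p) (n + q)) (w := fun p => w (n + p))
        (B := cornerCube d (2 ^ k)) (B' := cornerCube d (2 ^ (k + 1)))
        (v := ((2 ^ k : ℕ) : ℤ) • e) (fun p => hρ0 _) (fun _ _ _ => htri _ _ _) (fun _ => hw0 _)
        (fun p i => by rw [← add_assoc]; exact hw _ _)
        (fun i => by
          simp only [Pi.zero_apply, Pi.smul_apply, smul_eq_mul]
          exact mul_nonneg (by positivity) (he i).1)
        (by
          intro p hp u hu huv
          rw [mem_cornerCube] at hp ⊢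
          intro i
          have h1 := hp i
          have h2 := hu i
          have h3 := huv i
          have h4 := he i
          simp only [Pi.zero_apply, Pi.smul_apply, smul_eq_mul, Pi.add_apply] at *
          have h5 : e i ≤ 1 := by push_cast at h4; omega
          have h6 : ((2 ^ k : ℕ) : ℤ) * e i ≤ (2 ^ k : ℕ) :=
            mul_le_of_le_one_right (by positivity) h5
          rw [pow_succ]
          push_cast at *
          constructor <;> linarith)
      have h2 : ((∑ i, (((2 ^ k : ℕ) : ℤ) • e) i : ℤ) : ℝ) ≤ d * 2 ^ k := by
        have : (∑ i, (((2 ^ k : ℕ) : ℤ) • e) i : ℤ) ≤ ∑ i : Fin d, ((2 ^ k : ℕ) : ℤ) := by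
          refine Finset.sum_le_sum fun i _ => ?_
          have h4 := he i
          have h5 : e i ≤ 1 := by push_cast at h4; omega
          exact mul_le_of_le_one_right (by positivity) h5
        simp only [Finset.sum_const, Finset.card_univ, Fintype.card_fin, nsmul_eq_mul] at this
        exact_mod_cast this
      have h3 := mul_le_mul_of_nonneg_right h2 hsw0
      have h4 : ∑ p ∈ cornerCube d (2 ^ k), ρ n (n + (p + ((2 ^ k : ℕ) : ℤ) • e)) ≤
          ∑ p ∈ cornerCube d (2 ^ k), ρ n (n + p)
          + ∑ p ∈ cornerCube d (2 ^ k), ρ (n + p) (n + (p + ((2 ^ k : ℕ) : ℤ) • e)) := by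
        rw [← Finset.sum_add_distrib]
        exact Finset.sum_le_sum fun p _ => htri _ _ _
      linarith
    have hsum := Finset.sum_le_sum hstep
    rw [← sum_cornerCube_two_mul (s := 2 ^ k) (by positivity) (fun p => ρ n (n + p)),
      ← pow_succ'] at hsum
    refine hsum.trans ?_
    rw [Finset.sum_const, card_cornerCube, nsmul_eq_mul]
    push_cast
    have hfin : (d * 2 ^ k : ℝ) * ∑ p ∈ cornerCube d (2 ^ (k + 1)), w (n + p)
        ≤ (2 ^ k) ^ d * (d * 2 ^ d * Y * (2 * β) ^ k) := by
      calc (d * 2 ^ k : ℝ) * ∑ p ∈ cornerCube d (2 ^ (k + 1)), w (n + p)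
          ≤ (d * 2 ^ k) * ((2 ^ (k + 1)) ^ d * β ^ (k + 1) * Y) := by gcongr
        _ = (2 ^ k) ^ d * (d * 2 ^ d * Y * (2 * β) ^ k) * β := by
            rw [mul_pow 2 β k, pow_succ (2 : ℝ) k, mul_pow, pow_succ β]; ring
        _ ≤ _ := mul_le_of_le_one_right (by positivity) hβ1
    calc (2 : ℝ) ^ d * (∑ p ∈ cornerCube d (2 ^ k), ρ n (n + p)
          + (d * 2 ^ k) * ∑ p ∈ cornerCube d (2 ^ (k + 1)), w (n + p))
        ≤ 2 ^ d * ((2 ^ k) ^ d * (d * 2 ^ d * Y * ((2 * β) ^ k / (2 * β - 1)))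
          + (2 ^ k) ^ d * (d * 2 ^ d * Y * (2 * β) ^ k)) := by gcongr
      _ = _ := by
        rw [pow_succ (2 : ℝ) k, mul_pow, pow_succ (2 * β) k]
        field_simp
        ring

/-- A discrete Morrey inequality: the distance across a dyadic cube is controlled by the
`ℓ^q`-norm of the edge lengths, `q > d`. -/
theorem discrete_morrey {q Y : ℝ} (hq : 1 ≤ q) (hdq : (d : ℝ) < q) (hY : 0 ≤ Y)
    (hρ0 : ∀ p, ρ p p = 0) (hsymm : ∀ p q, ρ p q = ρ q p)
    (htri : ∀ p q r, ρ p r ≤ ρ p q + ρ q r)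
    (hw0 : ∀ p, 0 ≤ w p) (hw : ∀ p i, ρ p (p + Pi.single i 1) ≤ w p)
    {B : Finset (Fin d → ℤ)} (hBY : ∑ p ∈ B, w p ^ q ≤ Y ^ q) {n v : Fin d → ℤ} {k : ℕ}
    (hB : ∀ p ∈ cornerCube d (2 ^ (k + 1)), n + p ∈ B) (hv : v ∈ cornerCube d (2 ^ k)) :
    ρ n (n + v) ≤ d * 2 ^ d * (2 / (2 * (2 : ℝ) ^ (-(d / q)) - 1) + 1)
      * ((2 * (2 : ℝ) ^ (-(d / q))) ^ k * Y) := by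
  rw [mem_cornerCube] at hv
  have hadd : ∀ p ∈ cornerCube d (2 ^ k), ∀ u, 0 ≤ u → u ≤ v →
      p + u ∈ cornerCube d (2 ^ (k + 1)) := by
    intro p hp u hu huv
    rw [mem_cornerCube] at hp ⊢
    intro i
    have h1 := hp i
    have h2 := hu i
    have h3 := huv i
    have h4 := hv i
    rw [pow_succ]
    push_cast at *
    simp only [Pi.zero_apply, Pi.add_apply] at *
    constructor <;> linarith
  have hv0 : 0 ≤ v := fun i => (hv i).1
  have a1 := cornerCube_avg_le (n := n) (k := k) hq hdq hY hρ0 htri hw0 hw hBY fun p hp => by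
    simpa using hB _ (hadd p hp 0 le_rfl hv0)
  have a2 := cornerCube_avg_le (n := n + v) (k := k) hq hdq hY hρ0 htri hw0 hw hBY
    fun p hp => by
      rw [add_assoc, add_comm v p]
      exact hB _ (hadd p hp v hv0 le_rfl)
  have a3 := sum_translate_le (ρ := fun p q => ρ (n + p) (n + q)) (w := fun p => w (n + p))
        (B := cornerCube d (2 ^ k)) (B' := cornerCube d (2 ^ (k + 1)))
        (fun p => hρ0 _) (fun _ _ _ => htri _ _ _) (fun _ => hw0 _)
        (fun p i => by rw [← add_assoc]; exact hw _ _) hv0 hadd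
  have hsw := sum_cornerCube_le hq hY hw0 hBY hB
  have hsw0 : 0 ≤ ∑ p ∈ cornerCube d (2 ^ (k + 1)), w (n + p) := Finset.sum_nonneg fun _ _ => hw0 _
  have hvs : ((∑ i, v i : ℤ) : ℝ) ≤ d * 2 ^ k := by
    have : (∑ i, v i : ℤ) ≤ ∑ i : Fin d, ((2 ^ k : ℕ) : ℤ) :=
      Finset.sum_le_sum fun i _ => (hv i).2.le
    simp only [Finset.sum_const, Finset.card_univ, Fintype.card_fin, nsmul_eq_mul] at this
    exact_mod_cast this
  have hβ1 : (2 : ℝ) ^ (-(d / q)) ≤ 1 := Real.rpow_le_one_of_one_le_of_nonpos (by norm_num) (by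
    have : 0 ≤ d / q := by positivity
    linarith)
  have hβ0 : (0 : ℝ) < (2 : ℝ) ^ (-(d / q)) := by positivity
  set β := (2 : ℝ) ^ (-(d / q)) with hβ
  have hfin : ((∑ i, v i : ℤ) : ℝ) * ∑ p ∈ cornerCube d (2 ^ (k + 1)), w (n + p)
      ≤ (2 ^ k) ^ d * (d * 2 ^ d * Y * (2 * β) ^ k) := by
    calc ((∑ i, v i : ℤ) : ℝ) * ∑ p ∈ cornerCube d (2 ^ (k + 1)), w (n + p)
        ≤ (d * 2 ^ k) * ((2 ^ (k + 1)) ^ d * β ^ (k + 1) * Y) := by gcongr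
      _ = (2 ^ k) ^ d * (d * 2 ^ d * Y * (2 * β) ^ k) * β := by
          rw [mul_pow 2 β k, pow_succ (2 : ℝ) k, mul_pow, pow_succ β]; ring
      _ ≤ _ := mul_le_of_le_one_right (by positivity) hβ1
  have hall : ∑ p ∈ cornerCube d (2 ^ k), ρ n (n + v) ≤
      ∑ p ∈ cornerCube d (2 ^ k), ρ n (n + p)
      + ∑ p ∈ cornerCube d (2 ^ k), ρ (n + p) (n + (p + v))
      + ∑ p ∈ cornerCube d (2 ^ k), ρ (n + v) (n + v + p) := by
    rw [← Finset.sum_add_distrib, ← Finset.sum_add_distrib]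
    refine Finset.sum_le_sum fun p _ => ?_
    have h1 := htri n (n + p) (n + v)
    have h2 := htri (n + p) (n + (p + v)) (n + v)
    rw [hsymm (n + (p + v)) (n + v), show n + (p + v) = n + v + p by abel] at h2
    rw [show n + (p + v) = n + v + p by abel]
    linarith
  rw [Finset.sum_const, card_cornerCube, nsmul_eq_mul] at hall
  push_cast at hall
  have hs : (0 : ℝ) < (2 ^ k) ^ d := by positivity
  refine le_of_mul_le_mul_left ?_ hs
  refine hall.trans ?_
  calc _ ≤ (2 ^ k) ^ d * (d * 2 ^ d * Y * ((2 * β) ^ k / (2 * β - 1)))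
        + (2 ^ k) ^ d * (d * 2 ^ d * Y * (2 * β) ^ k)
        + (2 ^ k) ^ d * (d * 2 ^ d * Y * ((2 * β) ^ k / (2 * β - 1))) :=
        add_le_add (add_le_add a1 (a3.trans hfin)) a2
    _ = _ := by ring

end Metric

section Stable

variable {d : ℕ} {F : (Fin d → ℤ) → ℝ}

theorem subadditive_le_mul_sum_abs (hF0 : ∀ n, 0 ≤ F n) (hFz : F 0 = 0)
    (hadd : ∀ n m, F (n + m) ≤ F n + F m) (hneg : ∀ n, F (-n) = F n) (n : Fin d → ℤ) :
    F n ≤ (∑ i, F (Pi.single i 1)) * ∑ i, |(n i : ℝ)| := by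
  have hnat : ∀ (k : ℕ) u, F (k • u) ≤ k * F u := by
    intro k u
    induction k with
    | zero => simp [hFz]
    | succ k ih =>
      rw [succ_nsmul]
      have := hadd (k • u) u
      push_cast
      linarith
  have hint : ∀ (k : ℤ) u, F (k • u) ≤ |(k : ℝ)| * F u := by
    intro k u
    obtain ⟨k, rfl | rfl⟩ := k.eq_nat_or_neg
    · simpa using hnat k u
    · simpa [hneg] using hnat k u
  have hsum : ∀ (s : Finset (Fin d)) (g : Fin d → Fin d → ℤ),
      F (∑ i ∈ s, g i) ≤ ∑ i ∈ s, F (g i) := by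
    intro s g
    classical
    induction s using Finset.induction_on with
    | empty => simp [hFz]
    | insert i s hi ih =>
      rw [Finset.sum_insert hi, Finset.sum_insert hi]
      exact (hadd _ _).trans (by linarith)
  have hn : n = ∑ i, n i • (Pi.single i 1 : Fin d → ℤ) := by
    conv_lhs => rw [← Finset.univ_sum_single n]
    refine Finset.sum_congr rfl fun i _ => ?_
    rw [← Pi.single_smul]; simp
  calc F n = F (∑ i, n i • (Pi.single i 1 : Fin d → ℤ)) := by rw [← hn]
    _ ≤ ∑ i, F (n i • (Pi.single i 1 : Fin d → ℤ)) := hsum _ _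
    _ ≤ ∑ i, |(n i : ℝ)| * F (Pi.single i 1) := Finset.sum_le_sum fun i _ => hint _ _
    _ ≤ ∑ i, |(n i : ℝ)| * ∑ j, F (Pi.single j 1) := by
      gcongr with i
      exact Finset.single_le_sum (f := fun j => F (Pi.single j 1)) (fun j _ => hF0 _)
        (Finset.mem_univ i)
    _ = _ := by rw [← Finset.sum_mul, mul_comm]

/-- A nonnegative even subadditive function on `ℤ^d` is asymptotic along rays to a seminorm. -/
theorem exists_seminorm_tendsto (hF0 : ∀ n, 0 ≤ F n) (hFz : F 0 = 0)
    (hadd : ∀ n m, F (n + m) ≤ F n + F m) (hneg : ∀ n, F (-n) = F n) :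
    ∃ L : Seminorm ℝ (Fin d → ℝ), ∀ n : Fin d → ℤ,
      Tendsto (fun j : ℕ => F (j • n) / j) atTop (𝓝 (L fun i => (n i : ℝ))) := by
  obtain ⟨C, hC0, hC⟩ : ∃ C : ℝ, 0 ≤ C ∧ ∀ n, F n ≤ C * ∑ i, |(n i : ℝ)| :=
    ⟨_, Finset.sum_nonneg fun i _ => hF0 _, subadditive_le_mul_sum_abs hF0 hFz hadd hneg⟩
  have hCb : ∀ (n : Fin d → ℤ) (b : ℝ), (∀ i, |(n i : ℝ)| ≤ b) → F n ≤ C * (d * b) := by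
    intro n b hb
    refine (hC n).trans ?_
    gcongr
    refine (Finset.sum_le_sum fun i _ => hb i).trans ?_
    simp
  have hdiff : ∀ (n m : Fin d → ℤ) (b : ℝ), (∀ i, |(n i : ℝ) - m i| ≤ b) →
      F n ≤ F m + C * (d * b) := by
    intro n m b hb
    have h1 := hadd m (n - m)
    rw [add_sub_cancel] at h1
    have h2 := hCb (n - m) b fun i => by simpa using hb i
    linarith
  have hlarge : ∀ (b : ℝ) {η : ℝ}, 0 < η → ∀ᶠ t : ℝ in atTop, b ≤ η * t := by
    intro b η hη
    filter_upwards [eventually_ge_atTop (b / η)] with t ht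
    rwa [div_le_iff₀' hη] at ht
  set fl : ℝ → (Fin d → ℝ) → Fin d → ℤ := fun t v i => ⌊t * v i⌋ with hfl
  set A : (Fin d → ℝ) → Set ℝ := fun v => {c | 0 ≤ c ∧ ∀ᶠ t : ℝ in atTop, F (fl t v) ≤ c * t}
    with hA
  have hbdd : ∀ v, BddBelow (A v) := fun v => ⟨0, fun c hc => hc.1⟩
  have hne : ∀ v, (A v).Nonempty := by
    intro v
    refine ⟨C * (d * (∑ i, |v i| + 1)), by positivity, ?_⟩
    filter_upwards [eventually_ge_atTop 1] with t ht
    have : F (fl t v) ≤ C * (d * ((∑ i, |v i|) * t + 1)) := by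
      refine hCb _ _ fun i => ?_
      have h1 : |v i| ≤ ∑ i, |v i| :=
        Finset.single_le_sum (f := fun i => |v i|) (fun _ _ => abs_nonneg _) (Finset.mem_univ i)
      have h2 : |t * v i| ≤ (∑ i, |v i|) * t := by
        rw [abs_mul, abs_of_nonneg (by linarith : 0 ≤ t), mul_comm]
        gcongr
      have h3 := Int.floor_le (t * v i)
      have h4 := Int.lt_floor_add_one (t * v i)
      rw [abs_le] at h2 ⊢
      constructor <;> simp only [hfl] <;> linarith
    refine this.trans ?_
    have : (∑ i, |v i|) * t + 1 ≤ (∑ i, |v i| + 1) * t := by linarith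
    calc C * (d * ((∑ i, |v i|) * t + 1)) ≤ C * (d * ((∑ i, |v i| + 1) * t)) := by gcongr
      _ = _ := by ring
  have hnn : ∀ v, 0 ≤ sInf (A v) := fun v => Real.sInf_nonneg fun c hc => hc.1
  have hle : ∀ v c, 0 ≤ c → (∀ η > 0, c + η ∈ A v) → sInf (A v) ≤ c := fun v c _ h =>
    le_of_forall_pos_le_add fun η hη => csInf_le (hbdd v) (h η hη)
  let L : Seminorm ℝ (Fin d → ℝ) := Seminorm.ofSMulLE (fun v => sInf (A v))
    (by
      refine le_antisymm (csInf_le (hbdd 0) ⟨le_rfl, Eventually.of_forall fun t => ?_⟩) (hnn 0)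
      have : fl t 0 = 0 := by ext i; simp [hfl]
      rw [this, hFz, zero_mul])
    (by
      intro v w
      refine le_of_forall_pos_le_add fun η hη => ?_
      obtain ⟨c, hc, hcv⟩ := exists_lt_of_csInf_lt (hne v)
        (show sInf (A v) < sInf (A v) + η / 3 by linarith)
      obtain ⟨c', hc', hcw⟩ := exists_lt_of_csInf_lt (hne w)
        (show sInf (A w) < sInf (A w) + η / 3 by linarith)
      have : c + c' + η / 3 ∈ A (v + w) := by
        refine ⟨by linarith [hc.1, hc'.1], ?_⟩
        filter_upwards [hc.2, hc'.2, hlarge (C * (d * 2)) (show 0 < η / 3 by linarith)]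
          with t h1 h2 h3
        have h4 := hdiff (fl t (v + w)) (fl t v + fl t w) 2 fun i => by
          have a1 := Int.floor_le (t * (v i + w i))
          have a2 := Int.lt_floor_add_one (t * (v i + w i))
          have b1 := Int.floor_le (t * v i)
          have b2 := Int.lt_floor_add_one (t * v i)
          have c1 := Int.floor_le (t * w i)
          have c2 := Int.lt_floor_add_one (t * w i)
          simp only [hfl, Pi.add_apply, Int.cast_add]
          rw [mul_add] at *
          rw [abs_le]
          constructor <;> linarith
        have h5 := hadd (fl t v) (fl t w)
        linarith
      have := csInf_le (hbdd (v + w)) this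
      linarith)
    (by
      intro r v
      rcases eq_or_ne r 0 with rfl | hr
      · simp only [zero_smul, norm_zero, zero_mul]
        refine csInf_le (hbdd 0) ⟨le_rfl, Eventually.of_forall fun t => ?_⟩
        have : fl t 0 = 0 := by ext i; simp [hfl]
        rw [this, hFz, zero_mul]
      have hr' : 0 < ‖r‖ := norm_pos_iff.2 hr
      refine le_of_forall_pos_le_add fun η hη => ?_
      obtain ⟨c, hc, hcv⟩ := exists_lt_of_csInf_lt (hne v)
        (show sInf (A v) < sInf (A v) + η / 2 / ‖r‖ by
          have : 0 < η / 2 / ‖r‖ := by positivity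
          linarith)
      have : ‖r‖ * c + η / 2 ∈ A (r • v) := by
        refine ⟨by have := hc.1; positivity, ?_⟩
        have hscale : Tendsto (fun t : ℝ => ‖r‖ * t) atTop atTop :=
          tendsto_id.const_mul_atTop hr'
        filter_upwards [hscale.eventually hc.2, hlarge (C * (d * 2)) (show 0 < η / 2 by linarith)]
          with t h1 h3
        have h4 : F (fl t (r • v)) ≤ F (fl (‖r‖ * t) v) + C * (d * 2) := by
          rcases le_or_gt 0 r with h0 | h0
          · have : fl t (r • v) = fl (‖r‖ * t) v := by
              ext i
              simp only [hfl, Pi.smul_apply, smul_eq_mul, Real.norm_of_nonneg h0]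
              congr 1; ring
            rw [this]
            have : 0 ≤ C * (d * 2) := by positivity
            linarith
          · rw [← hneg (fl (‖r‖ * t) v)]
            refine hdiff _ _ 2 fun i => ?_
            have e : t * (r * v i) = -(‖r‖ * t * v i) := by
              rw [Real.norm_of_nonpos h0.le]; ring
            simp only [hfl, Pi.smul_apply, smul_eq_mul, Pi.neg_apply, Int.cast_neg, e]
            have a1 := Int.floor_le (-(‖r‖ * t * v i))
            have a2 := Int.lt_floor_add_one (-(‖r‖ * t * v i))
            have b1 := Int.floor_le (‖r‖ * t * v i)
            have b2 := Int.lt_floor_add_one (‖r‖ * t * v i)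
            rw [abs_le]
            constructor <;> linarith
        linarith
      have := csInf_le (hbdd (r • v)) this
      have h6 : ‖r‖ * (sInf (A v) + η / 2 / ‖r‖) = ‖r‖ * sInf (A v) + η / 2 := by
        field_simp
      have := mul_lt_mul_of_pos_left hcv hr'
      linarith)
  refine ⟨L, fun n => ?_⟩
  have hsub : Subadditive fun j : ℕ => F (j • n) := fun i j => by
    simpa only [add_nsmul] using hadd (i • n) (j • n)
  have hlim := hsub.tendsto_lim ⟨0, by rintro _ ⟨j, rfl⟩; exact div_nonneg (hF0 _) (by positivity)⟩
  have hnn' : 0 ≤ hsub.lim :=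
    ge_of_tendsto' hlim fun j => div_nonneg (hF0 _) (by positivity)
  have hfln : ∀ j : ℕ, fl j (fun i => (n i : ℝ)) = j • n := by
    intro j
    ext i
    simp only [hfl, Pi.smul_apply, nsmul_eq_mul]
    exact_mod_cast Int.floor_intCast ((j : ℤ) * n i)
  convert hlim
  change sInf (A fun i => (n i : ℝ)) = hsub.lim
  refine le_antisymm ?_ (le_csInf (hne _) ?_)
  · refine hle _ _ hnn' fun η hη => ⟨by linarith, ?_⟩
    have h1 := ((tendsto_order.1 hlim).2 (hsub.lim + η / 2) (by linarith)).and
      (eventually_gt_atTop 0)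
    filter_upwards [tendsto_nat_floor_atTop.eventually h1,
      hlarge (C * (d * (∑ i, |(n i : ℝ)| + 1))) (show 0 < η / 2 by linarith),
      eventually_ge_atTop 0] with t h2 h3 ht
    have hj : (0 : ℝ) < ⌊t⌋₊ := by exact_mod_cast h2.2
    have h4 := (div_lt_iff₀ hj).1 h2.1
    have h5 := Nat.floor_le ht
    have h6 := Nat.lt_floor_add_one t
    have h7 := hdiff (fl t fun i => (n i : ℝ)) (⌊t⌋₊ • n) (∑ i, |(n i : ℝ)| + 1) fun i => by
      have b0 : |(n i : ℝ)| ≤ ∑ i, |(n i : ℝ)| :=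
        Finset.single_le_sum (f := fun i => |(n i : ℝ)|) (fun _ _ => abs_nonneg _)
          (Finset.mem_univ i)
      have b1 : |(t - ⌊t⌋₊) * n i| ≤ ∑ i, |(n i : ℝ)| := by
        rw [abs_mul]
        refine le_trans (mul_le_of_le_one_left (abs_nonneg _) ?_) b0
        rw [abs_le]; constructor <;> linarith
      have a1 := Int.floor_le (t * (n i : ℝ))
      have a2 := Int.lt_floor_add_one (t * (n i : ℝ))
      simp only [hfl, Pi.smul_apply, nsmul_eq_mul, Int.cast_mul, Int.cast_natCast]
      rw [abs_le] at b1 ⊢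
      constructor <;> linarith
    have h8 : (hsub.lim + η / 2) * ⌊t⌋₊ ≤ (hsub.lim + η / 2) * t := by gcongr
    linarith
  · rintro c ⟨-, hc⟩
    refine le_of_tendsto hlim ?_
    filter_upwards [tendsto_natCast_atTop_atTop.eventually hc, eventually_gt_atTop 0] with j h1 h2
    have hj : (0 : ℝ) < j := by exact_mod_cast h2
    rw [div_le_iff₀ hj, ← hfln]
    exact h1

end Stable

theorem shape_of_dyadic_limits {d : ℕ} {ρ : (Fin d → ℤ) → (Fin d → ℤ) → ℝ} {w : (Fin d → ℤ) → ℝ}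
    {q : ℝ} (hq : 1 ≤ q) (hdq : (d : ℝ) < q)
    (hρ0 : ∀ p, ρ p p = 0) (hsymm : ∀ p q, ρ p q = ρ q p)
    (htri : ∀ p q r, ρ p r ≤ ρ p q + ρ q r)
    (hw0 : ∀ p, 0 ≤ w p) (hw : ∀ p i, ρ p (p + Pi.single i 1) ≤ w p)
    (L : Seminorm ℝ (Fin d → ℝ))
    (hlim : ∀ m : Fin d → ℤ, Tendsto (fun K : ℕ => ρ 0 (2 ^ K • m) / 2 ^ K) atTop
      (𝓝 (L fun i => (m i : ℝ))))
    {A : ℝ} (hA0 : 0 ≤ A)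
    (hA : ∀ N : ℕ, ∑ p ∈ latticeCube 0 N, w p ^ q ≤ A * (2 * N + 1) ^ d) (δ : ℝ) (hδ : 0 < δ) :
    {n : Fin d → ℤ | δ * (∑ i, |(n i : ℝ)|) ≤ |ρ 0 n - L (fun i => (n i : ℝ))|}.Finite := by
  have hq0 : 0 < q := by linarith
  set β := (2 : ℝ) ^ (-(d / q)) with hβ
  set C := (d : ℝ) * 2 ^ d * (2 / (2 * β - 1) + 1) with hC
  obtain ⟨CL, hCL0, hCL⟩ : ∃ CL : ℝ, 0 ≤ CL ∧ ∀ (v : Fin d → ℝ) b, (∀ i, |v i| ≤ b) →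
      L v ≤ CL * b := by
    refine ⟨∑ i, L (Pi.single i 1), Finset.sum_nonneg fun i _ => apply_nonneg L _,
      fun v b hb => ?_⟩
    calc L v = L (∑ i, v i • (Pi.single i 1 : Fin d → ℝ)) := by
          congr 1
          conv_lhs => rw [← Finset.univ_sum_single v]
          refine Finset.sum_congr rfl fun i _ => ?_
          rw [← Pi.single_smul]; simp
      _ ≤ ∑ i, L (v i • (Pi.single i 1 : Fin d → ℝ)) :=
          Finset.le_sum_of_subadditive L (map_zero L).le (map_add_le_add L) _ _
      _ ≤ ∑ i, L (Pi.single i 1) * b := by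
          refine Finset.sum_le_sum fun i _ => ?_
          rw [map_smul_eq_mul, mul_comm, Real.norm_eq_abs]
          exact mul_le_mul_of_nonneg_left (hb i) (apply_nonneg L _)
      _ = _ := by rw [Finset.sum_mul]
  -- choice of the mesh
  obtain ⟨R, hR1, hR2, hR3⟩ : ∃ R : ℕ, 1 ≤ R ∧ C * (A * (9 * R) ^ d) ^ (1 / q) ≤ δ / 4 * R ∧
      CL ≤ δ / 4 * R := by
    have h1 : Tendsto (fun R : ℕ => (R : ℝ) ^ (-(1 - d / q))) atTop (𝓝 0) :=
      (tendsto_rpow_neg_atTop (by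
        rw [sub_pos, div_lt_one hq0]; exact hdq)).comp tendsto_natCast_atTop_atTop
    have h2 : Tendsto (fun R : ℕ => C * (A * 9 ^ d) ^ (1 / q) * (R : ℝ) ^ (-(1 - d / q))) atTop
        (𝓝 0) := by simpa using h1.const_mul (C * (A * 9 ^ d) ^ (1 / q))
    have h3 : ∀ᶠ R : ℕ in atTop, CL / (δ / 4) ≤ R :=
      tendsto_natCast_atTop_atTop.eventually_ge_atTop _
    obtain ⟨R, hR, hR', hR''⟩ := (((tendsto_order.1 h2).2 (δ / 4) (by positivity)).and
      (h3.and (eventually_ge_atTop 1))).exists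
    refine ⟨R, hR'', ?_, by rwa [div_le_iff₀' (by positivity)] at hR'⟩
    have hRp : (0 : ℝ) < R := by exact_mod_cast hR''
    have e1 : (A * (9 * R) ^ d) ^ (1 / q)
        = (A * 9 ^ d) ^ (1 / q) * (R : ℝ) ^ (-(1 - d / q)) * R := by
      rw [mul_pow, ← mul_assoc, Real.mul_rpow (by positivity) (by positivity), mul_assoc]
      congr 1
      rw [← Real.rpow_natCast, ← Real.rpow_mul hRp.le]
      nth_rw 3 [← Real.rpow_one (R : ℝ)]
      rw [← Real.rpow_add hRp]
      congr 1
      ring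
    rw [e1]
    calc _ = C * (A * 9 ^ d) ^ (1 / q) * (R : ℝ) ^ (-(1 - d / q)) * R := by ring
      _ ≤ _ := by gcongr
  have hRp : (0 : ℝ) < R := by exact_mod_cast hR1
  -- uniformity over the finitely many directions
  obtain ⟨K₀, hK₀⟩ : ∃ K₀ : ℕ, ∀ K ≥ K₀, ∀ m ∈ latticeCube (0 : Fin d → ℤ) (2 * R),
      |ρ 0 (2 ^ K • m) - 2 ^ K * L fun i => (m i : ℝ)| ≤ δ / 4 * 2 ^ K := by
    refine eventually_atTop.1 ?_
    rw [Filter.eventually_all_finset]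
    intro m _
    filter_upwards [Metric.tendsto_nhds.1 (hlim m) (δ / 4) (by positivity)] with K hK
    rw [Real.dist_eq] at hK
    have h2 : (0 : ℝ) < 2 ^ K := by positivity
    have : ρ 0 (2 ^ K • m) - 2 ^ K * L (fun i => (m i : ℝ))
        = (ρ 0 (2 ^ K • m) / 2 ^ K - L fun i => (m i : ℝ)) * 2 ^ K := by
      field_simp
    rw [this, abs_mul, abs_of_pos h2]
    gcongr
  refine (latticeCube (0 : Fin d → ℤ) (R * 2 ^ K₀)).finite_toSet.subset ?_
  intro n hn
  by_contra hout
  rw [Finset.mem_coe, mem_latticeCube] at hout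
  push Not at hout
  obtain ⟨i₀, hi₀⟩ := hout
  obtain ⟨i₁, -, hi₁⟩ := Finset.exists_max_image Finset.univ (fun i => (n i).natAbs)
    ⟨i₀, Finset.mem_univ _⟩
  set s := (n i₁).natAbs with hs
  have hsR : R * 2 ^ K₀ < s := by
    have h1 := hi₁ i₀ (Finset.mem_univ _)
    simp only [Pi.zero_apply, sub_zero] at hi₀
    have h2 : ((n i₀).natAbs : ℤ) = |n i₀| := Int.natCast_natAbs _
    push_cast at hi₀
    rw [← h2] at hi₀
    have : R * 2 ^ K₀ < (n i₀).natAbs := by exact_mod_cast hi₀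
    omega
  set K := Nat.log 2 (s / R) with hK
  have hsR0 : 2 ^ K₀ ≤ s / R := by
    rw [Nat.le_div_iff_mul_le hR1, mul_comm]; exact hsR.le
  have hne : s / R ≠ 0 := by
    have : 0 < 2 ^ K₀ := by positivity
    omega
  have hKlo : R * 2 ^ K ≤ s := by
    have := Nat.pow_log_le_self 2 hne
    rwa [Nat.le_div_iff_mul_le hR1, mul_comm] at this
  have hKhi : s < R * 2 ^ (K + 1) := by
    have := Nat.lt_pow_succ_log_self (b := 2) (by norm_num) (s / R)
    rwa [Nat.div_lt_iff_lt_mul hR1, mul_comm] at this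
  have hKK : K₀ ≤ K := Nat.le_log_of_pow_le (by norm_num) hsR0
  have h2K : (0 : ℤ) < 2 ^ K := by positivity
  set m : Fin d → ℤ := fun i => n i / 2 ^ K with hm
  set v : Fin d → ℤ := fun i => n i % 2 ^ K with hv
  have hsm : ∀ i, (2 ^ K • m) i = 2 ^ K * m i := fun i => by
    rw [Pi.smul_apply, nsmul_eq_mul]; push_cast; rfl
  have hnmv : n = 2 ^ K • m + v := by
    ext i
    rw [Pi.add_apply, hsm]
    exact (Int.mul_ediv_add_emod _ _).symm
  have hvm : v ∈ cornerCube d (2 ^ K) := by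
    rw [mem_cornerCube]
    intro i
    refine ⟨Int.emod_nonneg _ h2K.ne', ?_⟩
    push_cast
    exact Int.emod_lt_of_pos _ h2K
  have hnb : ∀ i, |n i| < 2 * R * 2 ^ K := by
    intro i
    have h1 := hi₁ i (Finset.mem_univ _)
    have h2 : ((n i).natAbs : ℤ) = |n i| := Int.natCast_natAbs _
    rw [← h2]
    have h3 : (n i).natAbs < 2 * R * 2 ^ K := by
      calc _ ≤ s := h1
        _ < _ := hKhi
        _ = _ := by ring
    exact_mod_cast h3
  have hmb : ∀ i, -(2 * R : ℤ) ≤ m i ∧ m i < 2 * R := by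
    intro i
    have := abs_lt.1 (hnb i)
    refine ⟨(Int.le_ediv_iff_mul_le h2K).2 (by linarith), Int.ediv_lt_of_lt_mul h2K this.2⟩
  have hmc : m ∈ latticeCube (0 : Fin d → ℤ) (2 * R) := by
    rw [mem_latticeCube]
    intro i
    have := hmb i
    simp only [Pi.zero_apply, sub_zero, abs_le]
    push_cast
    constructor <;> linarith
  set N : ℕ := 4 * R * 2 ^ K with hN
  have hBsub : ∀ p ∈ cornerCube d (2 ^ (K + 1)),
      2 ^ K • m + p ∈ latticeCube (0 : Fin d → ℤ) N := by
    intro p hp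
    rw [mem_cornerCube] at hp
    rw [mem_latticeCube]
    intro i
    have h1 := hp i
    have h2 := hmb i
    have hR' : (1 : ℤ) ≤ R := by exact_mod_cast hR1
    rw [pow_succ] at h1
    simp only [Pi.zero_apply, sub_zero, abs_le, Pi.add_apply, hsm, hN]
    push_cast at h1 ⊢
    constructor <;> nlinarith
  set Y := (A * (9 * R * 2 ^ K) ^ d) ^ (1 / q) with hY
  have hY0 : 0 ≤ Y := by positivity
  have hBY : ∑ p ∈ latticeCube 0 N, w p ^ q ≤ Y ^ q := by
    have : Y ^ q = A * (9 * R * 2 ^ K) ^ d := by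
      rw [hY, ← Real.rpow_mul (by positivity), one_div_mul_cancel hq0.ne', Real.rpow_one]
    rw [this]
    refine (hA N).trans ?_
    gcongr
    have : 1 ≤ R * 2 ^ K := Nat.mul_pos hR1 (by positivity)
    have : (1 : ℝ) ≤ R * 2 ^ K := by exact_mod_cast this
    rw [hN]
    push_cast
    linarith
  have hmor := discrete_morrey hq hdq hY0 hρ0 hsymm htri hw0 hw hBY hBsub hvm
  rw [← hnmv, ← hβ, ← hC] at hmor
  have hθY : (2 * β) ^ K * Y = (A * (9 * R) ^ d) ^ (1 / q) * 2 ^ K := by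
    have e1 : β ^ K * ((((2 : ℝ) ^ K) ^ d) ^ (1 / q)) = 1 := by
      rw [hβ, ← Real.rpow_natCast, ← Real.rpow_natCast, ← Real.rpow_natCast,
        ← Real.rpow_mul (by norm_num), ← Real.rpow_mul (by norm_num),
        ← Real.rpow_mul (by norm_num), ← Real.rpow_add (by norm_num)]
      convert Real.rpow_zero (2 : ℝ) using 2
      field_simp
      ring
    rw [hY, mul_pow (9 * (R : ℝ)), ← mul_assoc A, Real.mul_rpow (by positivity) (by positivity),
      mul_pow]
    calc _ = (A * (9 * R) ^ d) ^ (1 / q) * 2 ^ K * (β ^ K * ((((2 : ℝ) ^ K) ^ d) ^ (1 / q))) := by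
          ring
      _ = _ := by rw [e1, mul_one]
  rw [hθY, ← mul_assoc] at hmor
  -- comparison of the two scales
  set S := ∑ i, |(n i : ℝ)| with hS
  have hSK : (R : ℝ) * 2 ^ K ≤ S := by
    have h1 : (R * 2 ^ K : ℝ) ≤ s := by exact_mod_cast hKlo
    have h2 : ((s : ℕ) : ℝ) = |(n i₁ : ℝ)| := by rw [hs]; exact Nat.cast_natAbs _ |>.trans (by simp)
    rw [h2] at h1
    exact h1.trans (Finset.single_le_sum (f := fun i => |(n i : ℝ)|) (fun _ _ => abs_nonneg _)
      (Finset.mem_univ i₁))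
  have h2Kr : (0 : ℝ) < 2 ^ K := by positivity
  have hSpos : 0 < S := lt_of_lt_of_le (by positivity) hSK
  have b1 : ρ (2 ^ K • m) n ≤ δ / 4 * S := by
    calc _ ≤ _ := hmor
      _ ≤ δ / 4 * R * 2 ^ K := by gcongr
      _ = δ / 4 * (R * 2 ^ K) := by ring
      _ ≤ _ := by gcongr
  have b2 : |ρ 0 (2 ^ K • m) - 2 ^ K * L fun i => (m i : ℝ)| ≤ δ / 4 * S := by
    refine (hK₀ K hKK m hmc).trans ?_
    have : (2 : ℝ) ^ K ≤ R * 2 ^ K :=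
      le_mul_of_one_le_left h2Kr.le (by exact_mod_cast hR1)
    have := this.trans hSK
    gcongr
  have b3 : L (fun i => (v i : ℝ)) ≤ δ / 4 * S := by
    calc _ ≤ CL * 2 ^ K := hCL _ _ fun i => by
          have := (mem_cornerCube.1 hvm) i
          rw [abs_of_nonneg (by exact_mod_cast this.1)]
          exact_mod_cast this.2.le
      _ ≤ δ / 4 * R * 2 ^ K := by gcongr
      _ = δ / 4 * (R * 2 ^ K) := by ring
      _ ≤ _ := by gcongr
  have hcast : (fun i => (n i : ℝ)) = (2 : ℝ) ^ K • (fun i => (m i : ℝ)) + fun i => (v i : ℝ) := by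
    ext i
    have := congrFun hnmv i
    rw [Pi.add_apply, hsm] at this
    rw [this]; simp
  have hLs : L ((2 : ℝ) ^ K • fun i => (m i : ℝ)) = 2 ^ K * L fun i => (m i : ℝ) := by
    rw [map_smul_eq_mul, Real.norm_of_nonneg h2Kr.le]
  have l1 : L (fun i => (n i : ℝ)) ≤ 2 ^ K * L (fun i => (m i : ℝ)) + δ / 4 * S := by
    rw [hcast, ← hLs]
    exact (map_add_le_add L _ _).trans (by linarith)
  have l2 : 2 ^ K * L (fun i => (m i : ℝ)) ≤ L (fun i => (n i : ℝ)) + δ / 4 * S := by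
    rw [← hLs]
    have : (2 : ℝ) ^ K • (fun i => (m i : ℝ)) = (fun i => (n i : ℝ)) - fun i => (v i : ℝ) := by
      rw [hcast]; simp
    rw [this]
    exact (map_sub_le_add L _ _).trans (by linarith)
  have r1 := htri 0 (2 ^ K • m) n
  have r2 := htri 0 n (2 ^ K • m)
  rw [hsymm n] at r2
  have hn' : δ * S ≤ |ρ 0 n - L fun i => (n i : ℝ)| := hn
  have : |ρ 0 n - L fun i => (n i : ℝ)| ≤ 3 * (δ / 4 * S) := by
    rw [abs_le] at b2 ⊢
    constructor <;> linarith [b2.1, b2.2]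
  nlinarith [mul_pos hδ hSpos]

/-- A nonnegative subadditive cocycle `f` over the action `T` whose associated
kernel `(p, q) ↦ f (q - p) (T p x)` is symmetric. -/
structure IsMetricCocycle {X : Type*} [MeasurableSpace X] {d : ℕ} (T : (Fin d → ℤ) → X → X)
    (f : (Fin d → ℤ) → X → ℝ) : Prop where
  measurable : ∀ n, Measurable (f n)
  nonneg : ∀ n x, 0 ≤ f n x
  zero : ∀ x, f 0 x = 0
  add_le : ∀ n m x, f (n + m) x ≤ f n (T m x) + f m x
  neg_eq : ∀ n x, f (-n) (T n x) = f n x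

theorem action_iterate {X : Type*} {d : ℕ} {T : (Fin d → ℤ) → X → X} (hT0 : T 0 = id)
    (hTadd : ∀ n m : Fin d → ℤ, T (n + m) = T n ∘ T m)
    (n : Fin d → ℤ) (j : ℕ) : (T n)^[j] = T (j • n) := by
  induction j with
  | zero => simp [hT0]
  | succ j ih => rw [Function.iterate_succ, ih, succ_nsmul, hTadd]

theorem action_neg_apply {X : Type*} {d : ℕ} {T : (Fin d → ℤ) → X → X} (hT0 : T 0 = id)
    (hTadd : ∀ n m : Fin d → ℤ, T (n + m) = T n ∘ T m)
    (n : Fin d → ℤ) (x : X) : T (-n) (T n x) = x := by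
  have := congrFun (hTadd (-n) n) x
  rw [neg_add_cancel, hT0] at this
  exact this.symm

section Cocycle

variable {X : Type*} [MeasurableSpace X] {μ : Measure X} {d : ℕ} {T : (Fin d → ℤ) → X → X}

/-- Over an ergodic action, a function that does not increase along the action is a.e. constant. -/
theorem ae_eq_const_of_ae_le [IsProbabilityMeasure μ] (hT0 : T 0 = id)
    (hTadd : ∀ n m : Fin d → ℤ, T (n + m) = T n ∘ T m)
    (hTmp : ∀ n : Fin d → ℤ, MeasurePreserving (T n) μ μ)
    (herg : ∀ A : Set X, MeasurableSet A → (∀ n : Fin d → ℤ, T n ⁻¹' A = A) →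
      μ A = 0 ∨ μ A = 1)
    {φ : X → ℝ≥0∞} (hφ : Measurable φ) (hle : ∀ m, ∀ᵐ x ∂μ, φ (T m x) ≤ φ x) :
    ∃ c, ∀ᵐ x ∂μ, φ x = c := by
  have heq : ∀ m, ∀ᵐ x ∂μ, φ (T m x) = φ x := fun m => by
    filter_upwards [hle m, (hTmp m).quasiMeasurePreserving.ae (hle (-m))] with x h1 h2
    rw [action_neg_apply hT0 hTadd] at h2
    exact le_antisymm h1 h2
  refine exists_eventuallyEq_const_of_forall_separating (l := ae μ) MeasurableSet fun U hU => ?_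
  set A : Set X := ⋂ p, T p ⁻¹' (φ ⁻¹' U) with hA
  have hAm : MeasurableSet A := MeasurableSet.iInter fun p => (hTmp p).measurable (hφ hU)
  have hAinv : ∀ n, T n ⁻¹' A = A := fun n => by
    ext x
    simp only [hA, mem_preimage, mem_iInter]
    have e : ∀ p q, T p (T q x) = T (p + q) x := fun p q => by rw [hTadd]; rfl
    constructor
    · intro h p
      have := h (p - n)
      rwa [e, sub_add_cancel] at this
    · intro h p
      rw [e]
      exact h _
  have hae : ∀ᵐ x ∂μ, x ∈ A ↔ φ x ∈ U := by
    filter_upwards [ae_all_iff.2 heq] with x hx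
    simp [hA, hx]
  rcases herg A hAm hAinv with h | h
  · right
    filter_upwards [hae, measure_eq_zero_iff_ae_notMem.1 h] with x h1 h2
    rwa [← h1]
  · left
    filter_upwards [hae, (prob_compl_eq_zero_iff hAm).2 h |> measure_eq_zero_iff_ae_notMem.1]
      with x h1 h2
    rw [← h1]
    simpa using h2

theorem ae_tendsto_div_two_pow_zero (hTmp : ∀ n : Fin d → ℤ, MeasurePreserving (T n) μ μ)
    {h : X → ℝ≥0∞} (hm : Measurable h) (hfin : ∫⁻ x, h x ∂μ ≠ ⊤) (p : ℕ → Fin d → ℤ) :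
    ∀ᵐ x ∂μ, Tendsto (fun K : ℕ => h (T (p K) x) / 2 ^ K) atTop (𝓝 0) := by
  have hm' : ∀ K, Measurable fun x => h (T (p K) x) / 2 ^ K := fun K =>
    (hm.comp (hTmp (p K)).measurable).div_const _
  have hsum : ∫⁻ x, ∑' K : ℕ, h (T (p K) x) / 2 ^ K ∂μ ≠ ⊤ := by
    rw [lintegral_tsum fun K => (hm' K).aemeasurable]
    have : ∀ K, ∫⁻ x, h (T (p K) x) / 2 ^ K ∂μ = (∫⁻ x, h x ∂μ) * 2⁻¹ ^ K := fun K => by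
      simp_rw [ENNReal.div_eq_inv_mul]
      rw [lintegral_const_mul _ (show Measurable fun x => h (T (p K) x) from
          hm.comp (hTmp (p K)).measurable),
        (hTmp (p K)).lintegral_comp hm, mul_comm, ENNReal.inv_pow]
    simp_rw [this]
    rw [ENNReal.tsum_mul_left, ENNReal.tsum_geometric]
    refine ENNReal.mul_ne_top hfin ?_
    simp
  filter_upwards [ae_lt_top (Measurable.tsum hm') hsum] with x hx
  exact ENNReal.tendsto_atTop_zero_of_tsum_ne_top hx.ne

variable {f : (Fin d → ℤ) → X → ℝ}

theorem IsMetricCocycle.apply_le (hf : IsMetricCocycle T f) (hT0 : T 0 = id)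
    (hTadd : ∀ n m : Fin d → ℤ, T (n + m) = T n ∘ T m) (n m : Fin d → ℤ) (x : X) :
    f n (T m x) ≤ f n x + (f m x + f m (T n x)) := by
  have h1 := hf.add_le (n + m) (-m) (T m x)
  rw [add_neg_cancel_right, action_neg_apply hT0 hTadd, hf.neg_eq, add_comm n m] at h1
  have h2 := hf.add_le m n x
  linarith

theorem IsMetricCocycle.nsmul_add_le (hf : IsMetricCocycle T f) (hT0 : T 0 = id)
    (hTadd : ∀ n m : Fin d → ℤ, T (n + m) = T n ∘ T m) (n : Fin d → ℤ) (i j : ℕ) (x : X) :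
    f ((i + j) • n) x ≤ f (i • n) x + f (j • n) ((T n)^[i] x) := by
  rw [add_nsmul, add_comm (i • n), action_iterate hT0 hTadd, add_comm (f (i • n) x)]
  exact hf.add_le _ _ _

theorem IsMetricCocycle.nsmul_le_sum (hf : IsMetricCocycle T f) (hT0 : T 0 = id)
    (hTadd : ∀ n m : Fin d → ℤ, T (n + m) = T n ∘ T m) (n : Fin d → ℤ) (j : ℕ) (x : X) :
    f (j • n) x ≤ ∑ i ∈ Finset.range j, f n ((T n)^[i] x) := by
  induction j with
  | zero => simp [hf.zero]
  | succ j ih =>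
    rw [Finset.sum_range_succ]
    have := hf.nsmul_add_le hT0 hTadd n j 1 x
    rw [one_nsmul] at this
    linarith

theorem IsMetricCocycle.integrable_of_single (hf : IsMetricCocycle T f)
    (hTmp : ∀ n : Fin d → ℤ, MeasurePreserving (T n) μ μ)
    (h : ∀ i, Integrable (f (Pi.single i 1)) μ) (n : Fin d → ℤ) : Integrable (f n) μ := by
  have hadd : ∀ n m, Integrable (f n) μ → Integrable (f m) μ → Integrable (f (n + m)) μ := by
    intro n m hn hm
    refine (((hTmp m).integrable_comp_of_integrable hn).add hm).mono'
      (hf.measurable _).aestronglyMeasurable (Eventually.of_forall fun x => ?_)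
    rw [Real.norm_of_nonneg (hf.nonneg _ _)]
    exact hf.add_le n m x
  have hneg : ∀ n, Integrable (f n) μ → Integrable (f (-n)) μ := by
    intro n hn
    rw [← (hTmp n).integrable_comp (hf.measurable _).aestronglyMeasurable]
    exact hn.congr (Eventually.of_forall fun x => (hf.neg_eq n x).symm)
  have hzero : Integrable (f 0) μ := by
    rw [show f 0 = 0 from funext hf.zero]
    exact integrable_zero _ _ _
  let G : AddSubgroup (Fin d → ℤ) :=
    { carrier := {n | Integrable (f n) μ}
      add_mem' := fun {n m} hn hm => hadd n m hn hm
      zero_mem' := hzero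
      neg_mem' := fun {n} hn => hneg n hn }
  have hn : ∑ i, n i • (Pi.single i 1 : Fin d → ℤ) ∈ G :=
    G.sum_mem fun i _ => G.zsmul_mem (h i) _
  have e : ∑ i, n i • (Pi.single i 1 : Fin d → ℤ) = n := by
    conv_rhs => rw [← Finset.univ_sum_single n]
    refine Finset.sum_congr rfl fun i _ => ?_
    rw [← Pi.single_smul]; simp
  rw [e] at hn
  exact hn

theorem IsMetricCocycle.ae_tendsto_two_pow [IsProbabilityMeasure μ] (hf : IsMetricCocycle T f)
    (hT0 : T 0 = id)
    (hTadd : ∀ n m : Fin d → ℤ, T (n + m) = T n ∘ T m)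
    (hTmp : ∀ n : Fin d → ℤ, MeasurePreserving (T n) μ μ)
    (herg : ∀ A : Set X, MeasurableSet A → (∀ n : Fin d → ℤ, T n ⁻¹' A = A) →
      μ A = 0 ∨ μ A = 1)
    (hint : ∀ n, Integrable (f n) μ) (n : Fin d → ℤ) {ℓ : ℝ}
    (hℓ : Tendsto (fun j : ℕ => (∫ x, f (j • n) x ∂μ) / j) atTop (𝓝 ℓ)) :
    ∀ᵐ x ∂μ, Tendsto (fun K : ℕ => f (2 ^ K • n) x / 2 ^ K) atTop (𝓝 ℓ) := by
  set u : ℕ → X → ℝ≥0∞ := fun K x => ENNReal.ofReal (f (2 ^ K • n) x / 2 ^ K) with hu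
  have hum : ∀ K, Measurable (u K) := fun K => ((hf.measurable _).div_const _).ennreal_ofReal
  have h2pow : Tendsto (fun k : ℕ => 2 ^ k) atTop atTop :=
    tendsto_pow_atTop_atTop_of_one_lt (by norm_num : (1 : ℕ) < 2)
  have hℓ0 : 0 ≤ ℓ := ge_of_tendsto' hℓ fun j =>
    div_nonneg (integral_nonneg (hf.nonneg _)) j.cast_nonneg
  -- the averages along the orbit are asymptotically invariant
  have hu_le : ∀ m, ∀ᵐ x ∂μ, ∃ e : ℕ → ℝ≥0∞, Tendsto e atTop (𝓝 0) ∧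
      ∀ K, u K (T m x) ≤ u K x + e K := by
    intro m
    have hfin : ∫⁻ x, ENNReal.ofReal (f m x) ∂μ ≠ ⊤ := (hint m).lintegral_lt_top.ne
    have hmeas := (hf.measurable m).ennreal_ofReal
    filter_upwards [ae_tendsto_div_two_pow_zero hTmp hmeas hfin (fun _ => 0),
      ae_tendsto_div_two_pow_zero hTmp hmeas hfin (fun K => 2 ^ K • n)] with x h1 h2
    refine ⟨_, by simpa using h1.add h2, fun K => ?_⟩
    have h2K : (0 : ℝ) < 2 ^ K := by positivity
    have e2 : ENNReal.ofReal (2 ^ K) = 2 ^ K := by simp [ENNReal.ofReal_pow]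
    simp only [hu, ENNReal.ofReal_div_of_pos h2K, e2, hT0, id, ← ENNReal.add_div]
    refine ENNReal.div_le_div_right ?_ _
    rw [← ENNReal.ofReal_add (hf.nonneg _ _) (hf.nonneg _ _),
      ← ENNReal.ofReal_add (hf.nonneg _ _) (add_nonneg (hf.nonneg _ _) (hf.nonneg _ _))]
    exact ENNReal.ofReal_le_ofReal (hf.apply_le hT0 hTadd _ _ _)
  obtain ⟨c₀, hc₀⟩ := ae_eq_const_of_ae_le hT0 hTadd hTmp herg (φ := fun x => limsup (u · x) atTop)
    (Measurable.limsup hum) fun m => by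
      filter_upwards [hu_le m] with x ⟨e, he, hle⟩
      calc limsup (u · (T m x)) atTop ≤ limsup ((u · x) + e) atTop :=
            limsup_le_limsup (Eventually.of_forall hle)
        _ = _ := ENNReal.limsup_add_of_right_tendsto_zero he _
  obtain ⟨c₁, hc₁⟩ := ae_eq_const_of_ae_le hT0 hTadd hTmp herg (φ := fun x => liminf (u · x) atTop)
    (Measurable.liminf hum) fun m => by
      filter_upwards [hu_le m] with x ⟨e, he, hle⟩
      calc liminf (u · (T m x)) atTop ≤ liminf ((u · x) + e) atTop :=
            liminf_le_liminf (Eventually.of_forall hle)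
        _ = _ := ENNReal.liminf_add_of_right_tendsto_zero he _
  have hupper : c₀ ≤ ENNReal.ofReal ℓ := by
    by_contra! hlt
    obtain ⟨c, hc0, hℓc, hcc⟩ := ENNReal.lt_iff_exists_real_btwn.1 hlt
    rw [ENNReal.ofReal_lt_ofReal_iff_of_nonneg hℓ0] at hℓc
    obtain ⟨k, hk⟩ := ((hℓ.comp h2pow).eventually_lt_const hℓc).exists
    simp only [Function.comp_apply] at hk
    push_cast at hk
    have h2k : (0 : ℝ) < 2 ^ k := by positivity
    rw [div_lt_iff₀ h2k] at hk
    set σ := T (2 ^ k • n) with hσ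
    set h := f (2 ^ k • n) with hh
    have hσm : MeasurePreserving σ μ μ := hTmp _
    have hint' : ∀ i, Integrable (fun x => h (σ^[i] x)) μ := fun i =>
      (hσm.iterate i).integrable_comp_of_integrable (hint _)
    have key := eventually_integral_subadditive_le (μ := μ) hσm
      (a := fun j x => -∑ i ∈ Finset.range j, h (σ^[i] x)) (c := -(c * 2 ^ k))
      (fun j => (Finset.measurable_sum _ fun i _ =>
        (hf.measurable _).comp (hσm.iterate i).measurable).neg)
      (fun j => (integrable_finsetSum _ fun i _ => hint' i).neg)
      (fun i j x => by
        rw [Finset.sum_range_add, neg_add]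
        simp only [← Function.iterate_add_apply, add_comm i]
        exact le_rfl)
      (fun x => by simp) (by
        filter_upwards [hc₀] with x hx
        have hfr : ∃ᶠ K in atTop, ENNReal.ofReal c < u K x :=
          frequently_lt_of_lt_limsup (by isBoundedDefault) (by rw [hx]; exact hcc)
        obtain ⟨K, hK, hkK⟩ := (hfr.and_eventually (eventually_ge_atTop k)).exists
        obtain ⟨r, rfl⟩ := Nat.exists_eq_add_of_le hkK
        refine ⟨2 ^ r, Nat.one_le_two_pow, ?_⟩
        rw [hu, ENNReal.ofReal_lt_ofReal_iff_of_nonneg hc0, lt_div_iff₀ (by positivity)] at hK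
        have := hf.nsmul_le_sum hT0 hTadd (2 ^ k • n) (2 ^ r) x
        rw [smul_smul, ← pow_add, add_comm r k] at this
        have e : -(c * 2 ^ k) * ((2 ^ r : ℕ) : ℝ) = -(c * 2 ^ (k + r)) := by push_cast; ring
        rw [e]
        linarith)
      (η := (c * 2 ^ k - ∫ x, h x ∂μ) / 2) (by linarith)
    obtain ⟨J, hJ, hJ1⟩ := (key.and (eventually_ge_atTop 1)).exists
    have hJp : (1 : ℝ) ≤ J := by exact_mod_cast hJ1
    have e : ∫ x, -∑ i ∈ Finset.range J, h (σ^[i] x) ∂μ = -(J * ∫ x, h x ∂μ) := by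
      rw [integral_neg, integral_finsetSum _ fun i _ => hint' i]
      have : ∀ i, ∫ x, h (σ^[i] x) ∂μ = ∫ x, h x ∂μ := fun i => by
        conv_rhs => rw [← (hσm.iterate i).map_eq]
        rw [integral_map (hσm.iterate i).measurable.aemeasurable
          (hf.measurable _).aestronglyMeasurable]
      simp [this]
    rw [e] at hJ
    nlinarith
  have hlower : ENNReal.ofReal ℓ ≤ c₁ := by
    by_contra! hlt
    obtain ⟨c, hc0, hcc, hcℓ⟩ := ENNReal.lt_iff_exists_real_btwn.1 hlt
    rw [ENNReal.ofReal_lt_ofReal_iff_of_nonneg hc0] at hcℓ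
    have key := eventually_integral_subadditive_le (μ := μ) (hTmp n) (a := fun j => f (j • n)) (c := c)
      (fun j => hf.measurable _) (fun j => hint _)
      (fun i j x => hf.nsmul_add_le hT0 hTadd n i j x)
      (fun x => by simp [hf.zero]) (by
        filter_upwards [hc₁] with x hx
        have hfr : ∃ᶠ K in atTop, u K x < ENNReal.ofReal c :=
          frequently_lt_of_liminf_lt (by isBoundedDefault) (by rw [hx]; exact hcc)
        obtain ⟨K, hK⟩ := hfr.exists
        refine ⟨2 ^ K, Nat.one_le_two_pow, ?_⟩
        rw [hu, ENNReal.ofReal_lt_ofReal_iff_of_nonneg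
          (div_nonneg (hf.nonneg _ _) (by positivity)), div_lt_iff₀ (by positivity)] at hK
        push_cast
        exact hK.le)
      (η := (ℓ - c) / 2) (by linarith)
    have : ℓ ≤ c + (ℓ - c) / 2 := by
      refine le_of_tendsto hℓ ?_
      filter_upwards [key, eventually_ge_atTop 1] with J hJ hJ1
      have hJp : (1 : ℝ) ≤ J := by exact_mod_cast hJ1
      rwa [div_le_iff₀ (by linarith)]
    linarith
  filter_upwards [hc₀, hc₁] with x h0 h1
  have ht : Tendsto (u · x) atTop (𝓝 (ENNReal.ofReal ℓ)) :=
    tendsto_of_le_liminf_of_limsup_le (by rw [h1]; exact hlower) (by rw [h0]; exact hupper)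
  have := (ENNReal.tendsto_toReal ENNReal.ofReal_ne_top).comp ht
  rw [ENNReal.toReal_ofReal hℓ0] at this
  refine this.congr fun K => ENNReal.toReal_ofReal (div_nonneg (hf.nonneg _ _) (by positivity))

theorem IsMetricCocycle.exists_shape [IsProbabilityMeasure μ] (hf : IsMetricCocycle T f)
    (hT0 : T 0 = id)
    (hTadd : ∀ n m : Fin d → ℤ, T (n + m) = T n ∘ T m)
    (hTmp : ∀ n : Fin d → ℤ, MeasurePreserving (T n) μ μ)
    (herg : ∀ A : Set X, MeasurableSet A → (∀ n : Fin d → ℤ, T n ⁻¹' A = A) →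
      μ A = 0 ∨ μ A = 1)
    {q : ℝ} (hq : 1 ≤ q) (hdq : (d : ℝ) < q)
    (hfq : ∀ i, ∫⁻ x, ENNReal.ofReal (f (Pi.single i 1) x ^ q) ∂μ ≠ ⊤) :
    ∃ L : Seminorm ℝ (Fin d → ℝ), ∀ᵐ x ∂μ, ∀ δ > 0,
      {n : Fin d → ℤ | δ * (∑ i, |(n i : ℝ)|) ≤ |f n x - L (fun i => (n i : ℝ))|}.Finite := by
  have hpow : ∀ i, Integrable (fun x => f (Pi.single i 1) x ^ q) μ := fun i =>
    (lintegral_ofReal_ne_top_iff_integrable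
      ((hf.measurable _).pow_const q).aestronglyMeasurable
      (Eventually.of_forall fun x => Real.rpow_nonneg (hf.nonneg _ x) q)).1 (hfq i)
  have hint : ∀ n, Integrable (f n) μ := hf.integrable_of_single hTmp fun i => by
    refine ((integrable_const (1 : ℝ)).add (hpow i)).mono'
      (hf.measurable _).aestronglyMeasurable (Eventually.of_forall fun x => ?_)
    have h0 := hf.nonneg (Pi.single i 1) x
    rw [Real.norm_of_nonneg h0]
    show _ ≤ 1 + f (Pi.single i 1) x ^ q
    rcases le_total (f (Pi.single i 1) x) 1 with h1 | h1
    · linarith [Real.rpow_nonneg h0 q]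
    · linarith [Real.self_le_rpow_of_one_le h1 hq]
  obtain ⟨L, hL⟩ := exists_seminorm_tendsto (F := fun n => ∫ x, f n x ∂μ)
    (fun n => integral_nonneg (hf.nonneg n))
    (by simp [hf.zero])
    (fun n m => by
      have e : ∫ x, f n (T m x) ∂μ = ∫ x, f n x ∂μ := by
        conv_rhs => rw [← (hTmp m).map_eq]
        rw [integral_map (hTmp m).measurable.aemeasurable
          (hf.measurable _).aestronglyMeasurable]
      have hi := (hTmp m).integrable_comp_of_integrable (hint n)
      rw [← e]
      exact (integral_mono (hint _) (hi.add (hint m)) (hf.add_le n m)).trans_eq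
        (integral_add hi (hint m)))
    (fun n => by
      conv_lhs => rw [← (hTmp n).map_eq]
      rw [integral_map (hTmp n).measurable.aemeasurable (hf.measurable _).aestronglyMeasurable]
      simp_rw [hf.neg_eq])
  set W : X → ℝ := fun x => ∑ i, f (Pi.single i 1) x with hW
  have hW0 : ∀ x, 0 ≤ W x := fun x => Finset.sum_nonneg fun i _ => hf.nonneg _ x
  have hWm : Measurable W := Finset.measurable_sum _ fun i _ => hf.measurable _
  have hWi : Integrable (fun x => W x ^ q) μ := by
    refine ((integrable_finsetSum Finset.univ fun i _ => hpow i).const_mul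
      ((Finset.univ : Finset (Fin d)).card ^ (q - 1) : ℝ)).mono'
      (hWm.pow_const q).aestronglyMeasurable (Eventually.of_forall fun x => ?_)
    rw [Real.norm_of_nonneg (Real.rpow_nonneg (hW0 x) q)]
    exact Real.rpow_sum_le_const_mul_sum_rpow_of_nonneg _ hq fun i _ => hf.nonneg _ x
  refine ⟨L, ?_⟩
  filter_upwards [ae_exists_cube_sum_le hTadd hTmp (hWm.pow_const q).ennreal_ofReal
      hWi.lintegral_lt_top.ne,
    ae_all_iff.2 fun n => hf.ae_tendsto_two_pow hT0 hTadd hTmp herg hint n (hL n)]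
    with x ⟨A, hA⟩ hlim δ hδ
  have hTT : ∀ p r, T (r - p) (T p x) = T r x := fun p r => by
    have := congrFun (hTadd (r - p) p) x
    rw [sub_add_cancel] at this
    exact this.symm
  have hbase : ∀ n, f (n - 0) (T 0 x) = f n x := fun n => by rw [sub_zero, hT0]; rfl
  have := shape_of_dyadic_limits (ρ := fun p r => f (r - p) (T p x)) (w := fun p => W (T p x))
    hq hdq (fun p => by simp [hf.zero])
    (fun p r => by
      have := hf.neg_eq (r - p) (T p x)
      rw [hTT, neg_sub] at this
      exact this.symm)
    (fun p r s => by
      have := hf.add_le (s - r) (r - p) (T p x)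
      rw [hTT, sub_add_sub_cancel] at this
      linarith)
    (fun p => hW0 _)
    (fun p i => by
      simp only [add_sub_cancel_left]
      exact Finset.single_le_sum (f := fun i => f (Pi.single i 1) (T p x))
        (fun i _ => hf.nonneg _ _) (Finset.mem_univ i))
    L (fun m => by simpa only [hbase] using hlim m) (A := A) A.cast_nonneg
    (fun N => by
      have h0 : ∀ p, 0 ≤ W (T p x) ^ q := fun p => Real.rpow_nonneg (hW0 _) q
      have := hA N
      rw [← ENNReal.ofReal_sum_of_nonneg fun p _ => h0 p] at this
      rw [← ENNReal.ofReal_le_ofReal_iff (by positivity)]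
      refine this.trans_eq ?_
      have e : ((A : ℝ) * (2 * N + 1) ^ d) = ((A * (2 * N + 1) ^ d : ℕ) : ℝ) := by push_cast; ring
      rw [e, ENNReal.ofReal_natCast]
      push_cast
      ring)
    δ hδ
  simpa only [hbase] using this

end Cocycle

/-- The positive part of the logarithm of the operator norm of a matrix. -/
noncomputable def posLogNorm {k : ℕ} (M : Matrix (Fin k) (Fin k) ℝ) : ℝ :=
  max (Real.log ‖Matrix.toEuclideanCLM (𝕜 := ℝ) M‖) 0

theorem posLogNorm_nonneg {k : ℕ} (M : Matrix (Fin k) (Fin k) ℝ) : 0 ≤ posLogNorm M :=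
  le_max_right _ _

theorem posLogNorm_mul_le {k : ℕ} (M N : Matrix (Fin k) (Fin k) ℝ) :
    posLogNorm (M * N) ≤ posLogNorm M + posLogNorm N := by
  have h : ∀ M : Matrix (Fin k) (Fin k) ℝ,
      posLogNorm M = Real.posLog ‖Matrix.toEuclideanCLM (𝕜 := ℝ) M‖ := fun M => max_comm _ _
  rw [h, h, h, map_mul]
  exact (Real.posLog_le_posLog (norm_nonneg _) (norm_mul_le _ _)).trans Real.posLog_mul

theorem posLogNorm_one {k : ℕ} : posLogNorm (1 : Matrix (Fin k) (Fin k) ℝ) = 0 := by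
  refine max_eq_right (Real.log_nonpos (norm_nonneg _) ?_)
  rw [map_one]
  exact ContinuousLinearMap.norm_id_le

theorem measurable_posLogNorm {X : Type*} [MeasurableSpace X] {k : ℕ}
    {M : X → Matrix (Fin k) (Fin k) ℝ} (hM : ∀ i j, Measurable fun x => M x i j) :
    Measurable fun x => posLogNorm (M x) := by
  have hc : Continuous fun A : Fin k → Fin k → ℝ =>
      ‖Matrix.toEuclideanCLM (𝕜 := ℝ) (Matrix.of A)‖ :=
    continuous_norm.comp (LinearMap.continuous_of_finiteDimensional
      ((Matrix.toEuclideanCLM (n := Fin k) (𝕜 := ℝ)).toAlgEquiv.toLinearMap ∘ₗ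
        (Matrix.ofLinearEquiv ℝ).toLinearMap))
  have hm : Measurable fun x => (fun i j => M x i j : Fin k → Fin k → ℝ) :=
    measurable_pi_lambda _ fun i => measurable_pi_lambda _ fun j => hM i j
  exact (Real.measurable_log.comp (hc.measurable.comp hm)).max measurable_const

/-- A symmetric subadditive size on `GL_k(ℝ)`. -/
noncomputable def logSize {k : ℕ} (g : GL (Fin k) ℝ) : ℝ :=
  max (posLogNorm (g : Matrix (Fin k) (Fin k) ℝ))
    (posLogNorm ((g⁻¹ : GL (Fin k) ℝ) : Matrix (Fin k) (Fin k) ℝ))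

theorem logSize_mul_le {k : ℕ} (g h : GL (Fin k) ℝ) : logSize (g * h) ≤ logSize g + logSize h := by
  refine max_le ?_ ?_
  · rw [Units.val_mul]
    exact (posLogNorm_mul_le _ _).trans (add_le_add (le_max_left _ _) (le_max_left _ _))
  · rw [mul_inv_rev, Units.val_mul, add_comm]
    exact (posLogNorm_mul_le _ _).trans (add_le_add (le_max_right _ _) (le_max_right _ _))

theorem logSize_one {k : ℕ} : logSize (1 : GL (Fin k) ℝ) = 0 := by
  simp [logSize, posLogNorm_one]

theorem exists_metricCocycle_eq_logSize {X : Type*} [MeasurableSpace X] {μ : Measure X}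
    {d k : ℕ} {T : (Fin d → ℤ) → X → X} (hT0 : T 0 = id)
    (hTadd : ∀ n m : Fin d → ℤ, T (n + m) = T n ∘ T m)
    (hTmp : ∀ n : Fin d → ℤ, MeasurePreserving (T n) μ μ)
    {S : (Fin d → ℤ) → X → GL (Fin k) ℝ}
    (hSmeas : ∀ (n : Fin d → ℤ) (i j : Fin k),
      Measurable fun x => ((S n x : Matrix (Fin k) (Fin k) ℝ) i j))
    (hS0 : ∀ᵐ x ∂μ, S 0 x = 1)
    (hScoc : ∀ n m : Fin d → ℤ, ∀ᵐ x ∂μ, S (n + m) x = S n (T m x) * S m x) :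
    ∃ f : (Fin d → ℤ) → X → ℝ, IsMetricCocycle T f ∧
      (∀ᵐ x ∂μ, ∀ n, f n x = logSize (S n x)) ∧
      ∀ n x, f n x ≤ max (posLogNorm (S n x : Matrix (Fin k) (Fin k) ℝ))
        (posLogNorm (S (-n) (T n x) : Matrix (Fin k) (Fin k) ℝ)) := by
  obtain ⟨G, hGae, hGm, hG⟩ := (hS0.and (ae_all_iff.2 fun n => ae_all_iff.2 fun m =>
    hScoc n m)).exists_measurable_mem
  set X₀ : Set X := ⋂ p, T p ⁻¹' G with hX₀
  have hX₀m : MeasurableSet X₀ := MeasurableSet.iInter fun p => (hTmp p).measurable hGm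
  have hX₀ae : ∀ᵐ x ∂μ, x ∈ X₀ := by
    simp only [hX₀, mem_iInter]
    exact ae_all_iff.2 fun p => (hTmp p).quasiMeasurePreserving.ae hGae
  have hT : ∀ p q x, T p (T q x) = T (p + q) x := fun p q x => by rw [hTadd]; rfl
  have hinv : ∀ m x, T m x ∈ X₀ ↔ x ∈ X₀ := fun m x => by
    simp only [hX₀, mem_iInter, mem_preimage, hT]
    exact ⟨fun h p => by simpa using h (p - m), fun h p => h _⟩
  have hcoc : ∀ x ∈ X₀, S 0 x = 1 ∧ ∀ n m, S (n + m) x = S n (T m x) * S m x := fun x hx =>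
    hG x (by simpa [hT0] using mem_iInter.1 hx 0)
  have hSinv : ∀ x ∈ X₀, ∀ n, S (-n) (T n x) = (S n x)⁻¹ := fun x hx n => by
    have := (hcoc x hx).2 (-n) n
    rw [neg_add_cancel, (hcoc x hx).1] at this
    exact eq_inv_of_mul_eq_one_left this.symm
  set F : (Fin d → ℤ) → X → ℝ := fun n x =>
    max (posLogNorm (S n x : Matrix (Fin k) (Fin k) ℝ))
      (posLogNorm (S (-n) (T n x) : Matrix (Fin k) (Fin k) ℝ)) with hF
  have hF0 : ∀ n x, 0 ≤ F n x := fun n x => (posLogNorm_nonneg _).trans (le_max_left _ _)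
  have hFS : ∀ x ∈ X₀, ∀ n, F n x = logSize (S n x) := fun x hx n => by
    simp only [hF, hSinv x hx]; rfl
  refine ⟨fun n => X₀.indicator (F n), ⟨fun n => ?_, fun n x => ?_, fun x => ?_,
    fun n m x => ?_, fun n x => ?_⟩, ?_, fun n x => ?_⟩
  · exact ((measurable_posLogNorm (hSmeas n)).max (measurable_posLogNorm fun i j =>
      (hSmeas (-n) i j).comp (hTmp n).measurable)).indicator hX₀m
  · exact indicator_nonneg (fun x _ => hF0 n x) x
  · by_cases hx : x ∈ X₀
    · rw [indicator_of_mem hx, hFS x hx, (hcoc x hx).1, logSize_one]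
    · exact indicator_of_notMem hx _
  · by_cases hx : x ∈ X₀
    · have hx' := (hinv m x).2 hx
      simp only [indicator_of_mem hx, indicator_of_mem hx', hFS x hx, hFS _ hx',
        (hcoc x hx).2 n m]
      exact logSize_mul_le _ _
    · have hx' := mt (hinv m x).1 hx
      simp [indicator_of_notMem hx, indicator_of_notMem hx']
  · by_cases hx : x ∈ X₀
    · have hx' := (hinv n x).2 hx
      simp only [indicator_of_mem hx, indicator_of_mem hx', hF, neg_neg,
        action_neg_apply hT0 hTadd]
      exact max_comm _ _
    · have hx' := mt (hinv n x).1 hx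
      simp [indicator_of_notMem hx, indicator_of_notMem hx']
  · filter_upwards [hX₀ae] with x hx n
    rw [indicator_of_mem hx, hFS x hx]
  · exact indicator_le_self' (fun x _ => hF0 n x) x

/-- **Shape theorem for linear cocycles over `ℤ^d`.** For a measurable
multiplicative cocycle `S : ℤ^d × X → GL_k(ℝ)` over an ergodic `ℤ^d`-space with
`log⁺‖S(n,·)‖ ∈ L^{d+ε}(μ)` for the generators, the random semimetric
`ρ_x(m,n) = max(log⁺‖S_n S_m⁻¹‖, log⁺‖S_m S_n⁻¹‖)` admits an asymptotic shape:
there is a seminorm `L` on `ℝ^d` with `(ρ_x(0,n) - L(n))/|n| → 0` a.e. -/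
theorem statement9
    {X : Type*} [MeasurableSpace X] (μ : Measure X) [IsProbabilityMeasure μ]
    (d k : ℕ) (hd : 1 ≤ d) (hk : 1 ≤ k)
    (T : (Fin d → ℤ) → X → X)
    (hT0 : T 0 = id)
    (hTadd : ∀ n m : Fin d → ℤ, T (n + m) = T n ∘ T m)
    (hTmp : ∀ n : Fin d → ℤ, MeasurePreserving (T n) μ μ)
    (herg : ∀ A : Set X, MeasurableSet A → (∀ n : Fin d → ℤ, T n ⁻¹' A = A) →
      μ A = 0 ∨ μ A = 1)
    (S : (Fin d → ℤ) → X → GL (Fin k) ℝ)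
    (hSmeas : ∀ (n : Fin d → ℤ) (i j : Fin k),
      Measurable fun x => ((S n x : Matrix (Fin k) (Fin k) ℝ) i j))
    (hS0 : ∀ᵐ x ∂μ, S 0 x = 1)
    (hScoc : ∀ n m : Fin d → ℤ, ∀ᵐ x ∂μ, S (n + m) x = S n (T m x) * S m x)
    (ρ : X → (Fin d → ℤ) → (Fin d → ℤ) → ℝ)
    (hρ : ∀ (x : X) (m n : Fin d → ℤ),
      ρ x m n = max
        (max (Real.log ‖Matrix.toEuclideanCLM (𝕜 := ℝ)
          ((S n x * (S m x)⁻¹ : GL (Fin k) ℝ) : Matrix (Fin k) (Fin k) ℝ)‖) 0)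
        (max (Real.log ‖Matrix.toEuclideanCLM (𝕜 := ℝ)
          ((S m x * (S n x)⁻¹ : GL (Fin k) ℝ) : Matrix (Fin k) (Fin k) ℝ)‖) 0))
    (ε : ℝ) (hε : 0 < ε)
    (hint : ∀ n : Fin d → ℤ, (∑ i, |n i|) = 1 →
      ∫⁻ x, ENNReal.ofReal
        ((max (Real.log ‖Matrix.toEuclideanCLM (𝕜 := ℝ)
            ((S n x : GL (Fin k) ℝ) : Matrix (Fin k) (Fin k) ℝ)‖) 0)
          ^ ((d : ℝ) + ε)) ∂μ < ⊤) :
    ∃ L : Seminorm ℝ (Fin d → ℝ), ∀ᵐ x ∂μ, ∀ δ > 0,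
      {n : Fin d → ℤ |
        δ * (∑ i, |(n i : ℝ)|) ≤ |ρ x 0 n - L (fun i => (n i : ℝ))|}.Finite := by
  obtain ⟨f, hf, hfS, hfle⟩ := exists_metricCocycle_eq_logSize hT0 hTadd hTmp hSmeas hS0 hScoc
  have hd' : (1 : ℝ) ≤ d := by exact_mod_cast hd
  obtain ⟨L, hL⟩ := hf.exists_shape (μ := μ) hT0 hTadd hTmp herg (q := d + ε) (by linarith)
    (by linarith) fun i => by
      have he : ∀ c : ℤ, |c| = 1 → ∑ j, |(Pi.single i c : Fin d → ℤ) j| = 1 := fun c hc => by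
        rw [Finset.sum_eq_single i (fun j _ hj => by simp [hj]) (by simp)]
        simpa using hc
      have h1 := hint (Pi.single i 1) (he 1 (by simp))
      have h2 := hint (-Pi.single i 1) (by rw [← Pi.single_neg]; exact he (-1) (by simp))
      have hmeas : ∀ n, Measurable fun x => ENNReal.ofReal
          (posLogNorm (S n x : Matrix (Fin k) (Fin k) ℝ) ^ ((d : ℝ) + ε)) := fun n =>
        ((measurable_posLogNorm (hSmeas n)).pow_const _).ennreal_ofReal
      have h3 := ((hTmp (Pi.single i 1)).lintegral_comp (hmeas (-Pi.single i 1))).trans_lt h2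
      refine ((lintegral_mono fun x => ?_).trans_lt
        ((lintegral_add_left (hmeas (Pi.single i 1)) _).trans_lt (ENNReal.add_lt_top.2
          ⟨h1, h3⟩))).ne
      refine (ENNReal.ofReal_le_ofReal (Real.rpow_le_rpow (hf.nonneg _ x) (hfle _ x)
        (by linarith))).trans ?_
      rcases max_cases (posLogNorm (S (Pi.single i 1) x : Matrix (Fin k) (Fin k) ℝ))
        (posLogNorm (S (-Pi.single i 1) (T (Pi.single i 1) x) : Matrix (Fin k) (Fin k) ℝ))
        with h | h
      · rw [h.1]; exact le_self_add
      · rw [h.1]; exact le_add_self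
  refine ⟨L, ?_⟩
  filter_upwards [hL, hfS, hS0] with x hx hxS hx0 δ hδ
  have e : ∀ n, ρ x 0 n = f n x := fun n => by
    rw [hxS, hρ, hx0, inv_one, mul_one, one_mul]; rfl
  simpa only [e] using hx δ hδ
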